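/- Let T : [0,1] → [0,1] be piecewise monotone and uniformly expanding with respect to a finite partition of [0,1] into intervals (on each partition interval T extends to a monotone C¹ map on a neighbourhood of its closure with |T′| ≥ λ > 1), with bounded distortion for T′ (there is D ≥ 1 such that |(Tⁿ)′(x)/(Tⁿ)′(y)| ≤ D whenever x,y lie in the same cylinder of generation n). Let φ : [0,1] → ℝ have bounded distortion, and suppose μ_φ = h_φ·ν_φ is a T-invariant Borel probability measure, where h_φ is bounded and bounded away from zero and ν_φ is conformal: ν_φ(T(A)) = ∫_A e^{P(φ)−φ} dν_φ for every measurable set A contained in a single partition interval, P(φ) being a real constant. Assume there is p : ℕ → (0,∞) with Σ p(n) < ∞ such that |∫ (f∘Tⁿ)·g dμ_φ − ∫ f dμ_φ · ∫ g dμ_φ| ≤ ‖f‖₁ (‖g‖₁ + Var g) p(n) for all f ∈ L¹(μ_φ), all g of bounded variation and all n. Finally assume there is s₀ > 0 such that for each s < s₀ there is c_s with μ_φ(I) ≤ c_s|I|^s for every interval I ⊂ [0,1]. If α > 1/s₀ and r_n = n^{−α}, then for μ_φ-almost every x the Hausdorff dimension of E(x,r) equals 1/α. -/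

import Mathlib

open MeasureTheory Filter Set

/-- `E(x,r)`: the set of `y ∈ [0,1]` such that `|Tⁿ x − y| < r n` for infinitely many `n`. -/
def hitSet (T : ℝ → ℝ) (x : ℝ) (r : ℕ → ℝ) : Set ℝ :=
  {y ∈ Set.Icc (0 : ℝ) 1 | ∃ᶠ n in Filter.atTop, |T^[n] x - y| < r n}

/-- `x` and `y` belong to the same cylinder of generation `n` for the map `T` with respect to
the partition `{[a i, a (i+1)) : i < m}` of `[0,1]`. -/
def SameCylinder (T : ℝ → ℝ) (m : ℕ) (a : ℕ → ℝ) (n : ℕ) (x y : ℝ) : Prop :=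
  ∀ k < n, ∃ i < m, T^[k] x ∈ Set.Ico (a i) (a (i + 1)) ∧ T^[k] y ∈ Set.Ico (a i) (a (i + 1))

/-- index of the dyadic interval of generation `l` containing `y`. -/
noncomputable def idx (l : ℕ) (y : ℝ) : ℤ := ⌊(2:ℝ) ^ l * y⌋

/-- dyadic interval. -/
def Dy (l : ℕ) (i : ℤ) : Set ℝ := {y | idx l y = i}

lemma idx_anc {l k : ℕ} (h : l ≤ k) (y : ℝ) : idx l y = idx k y / 2 ^ (k - l) := by
  unfold idx
  have h1 := Int.floor_div_natCast ((2:ℝ) ^ k * y) (2 ^ (k - l))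
  have h2 : (2:ℝ) ^ k * y / ((2 ^ (k - l) : ℕ) : ℝ) = 2 ^ l * y := by
    have : (2:ℝ) ^ k = 2 ^ l * 2 ^ (k - l) := by rw [← pow_add]; congr 1; omega
    rw [this]; push_cast; field_simp
  rw [h2] at h1
  rw [h1]; push_cast; rfl

lemma measurable_idx (l : ℕ) : Measurable (idx l) := by
  unfold idx
  exact Int.measurable_floor.comp (measurable_const.mul measurable_id)

lemma measurableSet_Dy (l : ℕ) (i : ℤ) : MeasurableSet (Dy l i) :=
  measurable_idx l (measurableSet_singleton i)

lemma mem_Dy_iff {l : ℕ} {i : ℤ} {y : ℝ} :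
    y ∈ Dy l i ↔ (i:ℝ) / 2 ^ l ≤ y ∧ y < ((i:ℝ) + 1) / 2 ^ l := by
  have : (0:ℝ) < 2 ^ l := by positivity
  unfold Dy idx
  rw [mem_ofPred_eq, Int.floor_eq_iff, div_le_iff₀ this, lt_div_iff₀ this, mul_comm]

lemma Dy_eq (l : ℕ) (i : ℤ) : Dy l i = Ico ((i:ℝ) / 2 ^ l) (((i:ℝ) + 1) / 2 ^ l) := by
  ext y; rw [mem_Dy_iff]; rfl

lemma Dy_subset {l k : ℕ} (h : l ≤ k) (i : ℤ) : Dy k i ⊆ Dy l (i / 2 ^ (k - l)) := by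
  intro y hy
  have hy : idx k y = i := hy
  show idx l y = _
  rw [idx_anc h, hy]

lemma Dy_disj (l : ℕ) {i j : ℤ} (h : i ≠ j) : Disjoint (Dy l i) (Dy l j) := by
  rw [Set.disjoint_left]
  intro y (hy : idx l y = i) (hy' : idx l y = j)
  exact h (hy ▸ hy')

lemma idx_range {l : ℕ} {y : ℝ} (hy : y ∈ Icc (0:ℝ) 1) : idx l y ∈ Finset.Icc (0:ℤ) (2 ^ l) := by
  have : (0:ℝ) < 2 ^ l := by positivity
  rw [Finset.mem_Icc]; unfold idx
  refine ⟨Int.floor_nonneg.2 (mul_nonneg this.le hy.1), ?_⟩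
  have : ((⌊(2:ℝ) ^ l * y⌋ : ℤ) : ℝ) ≤ 2 ^ l := 
    (Int.floor_le _).trans (by nlinarith [hy.2])
  exact_mod_cast this

lemma var_ind (a b : ℝ) (hab : a ≤ b) : 
    eVariationOn ((Ico a b).indicator (fun _ => (1:ℝ))) (Icc 0 1) ≤ 2 := by
  set g : ℝ → ℝ := fun x => if a ≤ x then 1 else 0 with hg
  set h : ℝ → ℝ := fun x => if b ≤ x then 1 else 0 with hh
  have hf : (Ico a b).indicator (fun _ => (1:ℝ)) = fun x => g x - h x := by
    funext x
    simp only [indicator, mem_Ico, hg, hh]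
    grind
  have mono : ∀ c : ℝ, eVariationOn (fun x : ℝ => if c ≤ x then (1:ℝ) else 0) (Icc 0 1) ≤ 1 := by
    intro c
    have hm : MonotoneOn (fun x : ℝ => if c ≤ x then (1:ℝ) else 0) (Icc 0 1) := by
      intro x _ y _ hxy
      dsimp only
      grind
    have := (hm.eVariationOn_eq (a := 0) (b := 1) (by simp) (by simp)).le
    rw [inter_self] at this
    refine this.trans ?_
    rw [show (1:ENNReal) = ENNReal.ofReal 1 by simp]
    apply ENNReal.ofReal_le_ofReal
    split_ifs <;> norm_num
  rw [hf]
  unfold eVariationOn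
  apply iSup_le
  rintro ⟨n, u, hu, us⟩
  dsimp only
  calc ∑ i ∈ Finset.range n, edist (g (u (i+1)) - h (u (i+1))) (g (u i) - h (u i)) 
      ≤ ∑ i ∈ Finset.range n, (edist (g (u (i+1))) (g (u i)) + edist (h (u (i+1))) (h (u i))) := by
        apply Finset.sum_le_sum
        intro i _
        rw [edist_dist, edist_dist, edist_dist, ← ENNReal.ofReal_add dist_nonneg dist_nonneg]
        apply ENNReal.ofReal_le_ofReal
        exact dist_sub_sub_le _ _ _ _
    _ ≤ 1 + 1 := by
        rw [Finset.sum_add_distrib]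
        exact add_le_add ((eVariationOn.sum_le hu us).trans (mono a))
           ((eVariationOn.sum_le hu us).trans (mono b))
    _ = 2 := by norm_num

lemma ediam_ball_le' (x r : ℝ) : Metric.ediam (Metric.ball x r) ≤ ENNReal.ofReal (2 * r) := by
  rw [Real.ball_eq_Ioo, Real.ediam_Ioo]
  exact ENNReal.ofReal_le_ofReal (by linarith)

lemma dim_upper (T : ℝ → ℝ) (x : ℝ) (α : ℝ) (hα : 0 < α) (r : ℕ → ℝ)
    (hr : ∀ n : ℕ, r n = (n : ℝ) ^ (-α)) : dimH (hitSet T x r) ≤ ENNReal.ofReal (1 / α) := by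
  have key : ∀ d : ℝ, 1 / α < d → dimH (hitSet T x r) ≤ ENNReal.ofReal d := by
    intro d hd
    have hd0 : 0 < d := lt_trans (by positivity) hd
    have hrnn : ∀ n, 0 ≤ r n := fun n => by rw [hr]; positivity
    have hrt : Tendsto r atTop (nhds 0) := by
      have := (tendsto_rpow_neg_atTop hα).comp tendsto_natCast_atTop_atTop
      exact this.congr (fun n => (hr n).symm)
    have hsum : Summable (fun n => (2 * r n) ^ d) := by
      have : Summable (fun n : ℕ => (2:ℝ) ^ d * (n:ℝ) ^ (-(α * d))) := by
        apply Summable.mul_left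
        rw [Real.summable_nat_rpow]
        have : 1 < d * α := by rwa [div_lt_iff₀ hα] at hd
        linarith
      refine this.congr (fun n => ?_)
      rw [Real.mul_rpow (by norm_num) (hrnn n), hr, ← Real.rpow_mul (by positivity)]
      ring_nf
    -- antitone sup radius
    have hanti : ∀ n : ℕ, 1 ≤ n → ∀ j : ℕ, r (n + j) ≤ r n := by
      intro n hn j
      rw [hr, hr]
      apply Real.rpow_le_rpow_of_nonpos (by positivity) (by push_cast; linarith [(Nat.cast_nonneg j : (0:ℝ) ≤ j)]) (by linarith)
    have h0 : μH[d] (hitSet T x r) ≤ 0 := by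
      have := Measure.hausdorffMeasure_le_liminf_tsum (X := ℝ) (β := ℕ) (ι := fun _ => ℕ) d (hitSet T x r)
        (l := atTop) (fun n => ENNReal.ofReal (2 * r n)) (by
          have := ENNReal.tendsto_ofReal (hrt.const_mul 2)
          simpa using this) (fun n j => Metric.ball (T^[n + j] x) (r (n + j))) (by
          filter_upwards [eventually_ge_atTop 1] with n hn j
          refine (ediam_ball_le' _ _).trans ?_
          exact ENNReal.ofReal_le_ofReal (by linarith [hanti n hn j])) (by
          filter_upwards with n y hy
          obtain ⟨k, hk, hk'⟩ := (frequently_atTop.1 hy.2) n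
          rw [mem_iUnion]
          refine ⟨k - n, ?_⟩
          rw [Nat.add_sub_cancel' hk, Metric.mem_ball, dist_comm]
          exact hk')
      refine this.trans ?_
      have ht : Tendsto (fun n => ∑' j, ENNReal.ofReal ((2 * r (j + n)) ^ d)) atTop (nhds 0) := by
        exact ENNReal.tendsto_sum_nat_add _ (by 
          rw [← ENNReal.ofReal_tsum_of_nonneg (fun n => by have := hrnn n; positivity) hsum]; exact ENNReal.ofReal_ne_top)
      rw [← ht.liminf_eq]
      refine liminf_le_liminf (Eventually.of_forall fun n => ?_)
      apply ENNReal.tsum_le_tsum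
      intro j
      rw [← ENNReal.ofReal_rpow_of_nonneg (by have := hrnn (j + n); positivity) hd0.le, add_comm j n]
      exact ENNReal.rpow_le_rpow (ediam_ball_le' _ _) hd0.le
    have h1 : μH[((⟨d, hd0.le⟩ : NNReal) : ℝ)] (hitSet T x r) ≠ ⊤ := by
      have : μH[d] (hitSet T x r) = 0 := le_antisymm h0 bot_le
      show μH[d] (hitSet T x r) ≠ ⊤
      rw [this]; simp
    have := dimH_le_of_hausdorffMeasure_ne_top h1
    rw [ENNReal.ofReal, Real.toNNReal_of_nonneg hd0.le]
    exact this
  have ht : Tendsto (fun d : ℝ => ENNReal.ofReal d) (nhdsWithin (1/α) (Ioi (1/α))) (nhds (ENNReal.ofReal (1/α))) :=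
    (ENNReal.continuous_ofReal.tendsto _).mono_left nhdsWithin_le_nhds
  refine ge_of_tendsto ht ?_
  filter_upwards [self_mem_nhdsWithin] with d hd
  exact key d hd

lemma div_comp {a b c : ℕ} (h1 : a ≤ b) (h2 : b ≤ c) (i : ℤ) :
    i / 2 ^ (c - b) / 2 ^ (b - a) = i / 2 ^ (c - a) := by
  rw [Int.ediv_ediv_of_nonneg (by positivity), ← pow_add]
  congr 2; omega

open Classical in
noncomputable def bcost (t : ℝ) (lev : ℕ → ℕ) (ind : ℕ → ℤ) (κ : ℕ) (i : ℤ) : ENNReal :=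
  ∑' m, if κ ≤ lev m ∧ ind m / 2 ^ (lev m - κ) = i then
    ENNReal.ofReal ((2:ℝ) ^ (-(lev m : ℝ) * t)) else 0

def BInv (t t2 : ℝ) (lev : ℕ → ℕ) (ind : ℕ → ℤ) (κ : ℕ) (i : ℤ) : Prop :=
  (∀ m, lev m < κ → i / 2 ^ (κ - lev m) ≠ ind m) ∧
    bcost t lev ind κ i < ENNReal.ofReal ((2:ℝ) ^ (-(κ : ℝ) * t2))

def StepProp (t t2 : ℝ) (Node Vis : ℕ → ℤ → Prop) (κ : ℕ) (i : ℤ) : Prop :=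
  ∃ κ' > κ, ∃ Ch : Finset ℤ, ∃ w : ℤ → ℝ,
    (∀ c ∈ Ch, Node κ' c ∧ Vis κ' c ∧ c / 2 ^ (κ' - κ) = i ∧ 0 ≤ w c ∧
      w c ≤ (2:ℝ) ^ ((κ:ℝ) * t2) * 2 ^ (-(κ':ℝ) * t2)) ∧
    1 ≤ ∑ c ∈ Ch, w c ∧
    ∀ l, κ < l → l < κ' → ∀ e : ℤ, ∑ c ∈ Ch with c / 2 ^ (κ' - l) = e, w c ≤
      (2:ℝ) ^ ((κ:ℝ) * t2) * 2 ^ (-(l:ℝ) * t)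

lemma branch_step {t t2 : ℝ} (ht : 0 < t) (ht2 : t ≤ t2) {Node Vis : ℕ → ℤ → Prop} {κ : ℕ} {i : ℤ}
    (hs : StepProp t t2 Node Vis κ i) {lev : ℕ → ℕ} {ind : ℕ → ℤ} (hI : BInv t t2 lev ind κ i) :
    ∃ κ' > κ, ∃ c : ℤ, Node κ' c ∧ Vis κ' c ∧ c / 2 ^ (κ' - κ) = i ∧ BInv t t2 lev ind κ' c := by
  classical
  obtain ⟨κ', hκ, Ch, w, hCh, hw1, hl⟩ := hs
  by_contra! hcon
  set g : ℕ → ENNReal := fun m => ENNReal.ofReal ((2:ℝ) ^ (-(lev m : ℝ) * t)) with hg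
  set V := ENNReal.ofReal ((2:ℝ) ^ ((κ:ℝ) * t2)) with hV
  have hbad : ∀ c ∈ Ch, (¬ ∃ m, lev m < κ' ∧ c / 2 ^ (κ' - lev m) = ind m) → 
      ENNReal.ofReal ((2:ℝ) ^ (-(κ' : ℝ) * t2)) ≤ bcost t lev ind κ' c := by
    intro c hc hm
    have h := hCh c hc
    have h' := hcon κ' hκ c h.1 h.2.1 h.2.2.1
    by_contra! hlt
    push Not at hm
    exact h' ⟨hm, hlt⟩
  set P1 := Ch.filter (fun c => ∃ m, lev m < κ' ∧ c / 2 ^ (κ' - lev m) = ind m) with hP1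
  set P2 := Ch.filter (fun c => ¬ ∃ m, lev m < κ' ∧ c / 2 ^ (κ' - lev m) = ind m) with hP2
  have hch : ∀ c, ∃ m, c ∈ P1 → lev m < κ' ∧ c / 2 ^ (κ' - lev m) = ind m := by
    intro c
    by_cases hc : c ∈ P1
    · obtain ⟨m, hm⟩ := (Finset.mem_filter.1 hc).2
      exact ⟨m, fun _ => hm⟩
    · exact ⟨0, fun h => absurd h hc⟩
  choose nm hnm using hch
  set F := P1.image nm with hF
  have hFprop : ∀ m ∈ F, κ < lev m ∧ lev m < κ' ∧ ind m / 2 ^ (lev m - κ) = i := by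
    intro m hm
    obtain ⟨c, hc, rfl⟩ := Finset.mem_image.1 hm
    have h1 := hnm c hc
    have hc' := hCh c (Finset.mem_filter.1 hc).1
    have hge : κ ≤ lev (nm c) := by
      by_contra! hlt
      apply hI.1 _ hlt
      rw [← hc'.2.2.1, div_comp hlt.le hκ.le, h1.2]
    have hi : ind (nm c) / 2 ^ (lev (nm c) - κ) = i := by
      rw [← h1.2, div_comp hge h1.1.le, hc'.2.2.1]
    refine ⟨lt_of_le_of_ne hge ?_, h1.1, hi⟩
    intro heq
    have h2 : g (nm c) ≤ bcost t lev ind κ i := by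
      unfold bcost
      refine le_trans ?_ (ENNReal.le_tsum (nm c))
      rw [if_pos ⟨hge, hi⟩]
    have h3 := lt_of_le_of_lt h2 hI.2
    apply absurd h3
    rw [not_lt]
    apply ENNReal.ofReal_le_ofReal
    apply Real.rpow_le_rpow_of_exponent_le (by norm_num)
    rw [← heq]
    nlinarith [(Nat.cast_nonneg κ : (0:ℝ) ≤ κ)]
  have e1 : (1:ENNReal) ≤ ∑ c ∈ Ch, ENNReal.ofReal (w c) := by
    rw [← ENNReal.ofReal_sum_of_nonneg (fun c hc => (hCh c hc).2.2.2.1)]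
    rw [← ENNReal.ofReal_one]
    exact ENNReal.ofReal_le_ofReal hw1
  have e2 : ∑ c ∈ P1, ENNReal.ofReal (w c) ≤ ∑ m ∈ F, V * g m := by
    rw [← Finset.sum_fiberwise_of_maps_to (g := nm) (t := F) (fun c hc => Finset.mem_image_of_mem _ hc)]
    apply Finset.sum_le_sum
    intro m hm
    obtain ⟨h1, h2, h3⟩ := hFprop m hm
    have := hl (lev m) h1 h2 (ind m)
    rw [hV, hg, ← ENNReal.ofReal_mul (by positivity)]
    refine le_trans ?_ (ENNReal.ofReal_le_ofReal this)
    rw [ENNReal.ofReal_sum_of_nonneg (fun c hc => (hCh c (Finset.mem_filter.1 hc).1).2.2.2.1)]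
    apply Finset.sum_le_sum_of_subset
    intro c hc
    rw [Finset.mem_filter] at hc ⊢
    refine ⟨(Finset.mem_filter.1 hc.1).1, ?_⟩
    have := (hnm c hc.1).2
    rw [hc.2] at this
    exact this
  have e3 : ∑ c ∈ P2, ENNReal.ofReal (w c) ≤ ∑ c ∈ P2, V * bcost t lev ind κ' c := by
    apply Finset.sum_le_sum
    intro c hc
    have hc' := Finset.mem_filter.1 hc
    calc ENNReal.ofReal (w c) ≤ ENNReal.ofReal ((2:ℝ) ^ ((κ:ℝ) * t2) * 2 ^ (-(κ':ℝ) * t2)) :=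
          ENNReal.ofReal_le_ofReal (hCh c hc'.1).2.2.2.2
      _ = V * ENNReal.ofReal (2 ^ (-(κ':ℝ) * t2)) := by rw [ENNReal.ofReal_mul (by positivity)]
      _ ≤ _ := by gcongr; exact hbad c hc'.1 hc'.2
  have e4 : ∑ m ∈ F, g m + ∑ c ∈ P2, bcost t lev ind κ' c ≤ bcost t lev ind κ i := by
    have h1 : ∑ m ∈ F, g m = ∑' m, if m ∈ F then g m else 0 := by
      rw [tsum_eq_sum (s := F) (fun m hm => if_neg hm)]
      exact Finset.sum_congr rfl (fun m hm => (if_pos hm).symm)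
    unfold bcost
    rw [h1, ← Summable.tsum_finsetSum (fun _ _ => ENNReal.summable), ← ENNReal.tsum_add]
    apply ENNReal.tsum_le_tsum
    intro m
    by_cases hm : lev m < κ'
    · have : ∑ c ∈ P2, (if κ' ≤ lev m ∧ ind m / 2 ^ (lev m - κ') = c then
          ENNReal.ofReal ((2:ℝ) ^ (-(lev m : ℝ) * t)) else 0) = 0 :=
        Finset.sum_eq_zero (fun c _ => if_neg (fun h => by omega))
      rw [this, add_zero]
      by_cases hmF : m ∈ F
      · have := hFprop m hmF
        rw [if_pos hmF, if_pos ⟨this.1.le, this.2.2⟩]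
      · rw [if_neg hmF]; exact bot_le
    · have hmF : m ∉ F := fun h => hm (hFprop m h).2.1
      push Not at hm
      rw [if_neg hmF, zero_add]
      simp only [hm, true_and]
      rw [Finset.sum_ite_eq]
      split_ifs with h1 h2 h2
      · exact le_rfl
      · exfalso; apply h2
        have := (hCh _ (Finset.mem_filter.1 h1).1).2.2.1
        rw [div_comp hκ.le hm] at this
        exact ⟨hκ.le.trans hm, this⟩
      · exact bot_le
      · exact bot_le
  have e5 : (1:ENNReal) ≤ V * bcost t lev ind κ i := by
    calc (1:ENNReal) ≤ ∑ c ∈ Ch, ENNReal.ofReal (w c) := e1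
      _ = ∑ c ∈ P1, ENNReal.ofReal (w c) + ∑ c ∈ P2, ENNReal.ofReal (w c) := 
        (Finset.sum_filter_add_sum_filter_not _ _ _).symm
      _ ≤ ∑ m ∈ F, V * g m + ∑ c ∈ P2, V * bcost t lev ind κ' c := add_le_add e2 e3
      _ = V * (∑ m ∈ F, g m + ∑ c ∈ P2, bcost t lev ind κ' c) := by
        rw [mul_add, Finset.mul_sum, Finset.mul_sum]
      _ ≤ _ := by gcongr
  have hVpos : V ≠ 0 := by rw [hV]; simp; positivity
  have hVtop : V ≠ ⊤ := ENNReal.ofReal_ne_top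
  have e6 : V * bcost t lev ind κ i < V * ENNReal.ofReal ((2:ℝ) ^ (-(κ : ℝ) * t2)) :=
    (ENNReal.mul_lt_mul_iff_right hVpos hVtop).2 hI.2
  have e7 : V * ENNReal.ofReal ((2:ℝ) ^ (-(κ : ℝ) * t2)) = 1 := by
    rw [hV, ← ENNReal.ofReal_mul (by positivity), ← Real.rpow_add (by norm_num)]
    simp
  rw [e7] at e6
  exact absurd e5 (not_le.2 e6)

lemma branch {t t2 : ℝ} (ht : 0 < t) (ht2 : t ≤ t2) {Node Vis : ℕ → ℤ → Prop}
    (hs : ∀ κ i, Node κ i → StepProp t t2 Node Vis κ i) {lev : ℕ → ℕ} {ind : ℕ → ℤ} 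
    {κ0 : ℕ} {i0 : ℤ} (h0 : Node κ0 i0)
    (hc : ∑' m, ENNReal.ofReal ((2:ℝ) ^ (-(lev m : ℝ) * t)) < ENNReal.ofReal ((2:ℝ) ^ (-(κ0 : ℝ) * t2))) :
    ∃ (κs : ℕ → ℕ) (is : ℕ → ℤ), StrictMono κs ∧ 
      (∀ n, is (n+1) / 2 ^ (κs (n+1) - κs n) = is n) ∧ (∀ n, Vis (κs (n+1)) (is (n+1))) ∧
      ∀ n m, lev m < κs n → is n / 2 ^ (κs n - lev m) ≠ ind m := by
  have hI0 : BInv t t2 lev ind κ0 i0 := by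
    refine ⟨?_, lt_of_le_of_lt ?_ hc⟩
    · intro m hm
      exfalso
      have := (ENNReal.le_tsum m).trans_lt hc
      apply absurd this
      rw [not_lt]
      apply ENNReal.ofReal_le_ofReal
      apply Real.rpow_le_rpow_of_exponent_le (by norm_num)
      have : (lev m : ℝ) ≤ κ0 := by exact_mod_cast hm.le
      nlinarith [(Nat.cast_nonneg κ0 : (0:ℝ) ≤ κ0)]
    · unfold bcost
      apply ENNReal.tsum_le_tsum
      intro m
      split_ifs
      · exact le_rfl
      · exact bot_le
  let S := {p : ℕ × ℤ // Node p.1 p.2 ∧ BInv t t2 lev ind p.1 p.2}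
  have hnext : ∀ p : S, ∃ q : S, p.1.1 < q.1.1 ∧ Vis q.1.1 q.1.2 ∧ q.1.2 / 2 ^ (q.1.1 - p.1.1) = p.1.2 := by
    rintro ⟨⟨κ, i⟩, hN, hI⟩
    obtain ⟨κ', h1, c, h2, h3, h4, h5⟩ := branch_step ht ht2 (hs κ i hN) hI
    exact ⟨⟨(κ', c), h2, h5⟩, h1, h3, h4⟩
  choose nx hnx using hnext
  let sq : ℕ → S := fun n => Nat.rec ⟨(κ0, i0), h0, hI0⟩ (fun _ p => nx p) n
  have hsq : ∀ n, sq (n+1) = nx (sq n) := fun n => rfl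
  refine ⟨fun n => (sq n).1.1, fun n => (sq n).1.2, ?_, ?_, ?_, ?_⟩
  · apply strictMono_nat_of_lt_succ
    intro n; rw [hsq]; exact (hnx _).1
  · intro n; dsimp only; rw [hsq]; exact (hnx _).2.2
  · intro n; dsimp only; rw [hsq]; exact (hnx _).2.1
  · intro n m; exact (sq n).2.2.1 m

def cDy (l : ℕ) (i : ℤ) : Set ℝ := Icc ((i:ℝ) / 2 ^ l) (((i:ℝ) + 1) / 2 ^ l)

lemma cDy_subset {l k : ℕ} (h : l ≤ k) (i : ℤ) : cDy k i ⊆ cDy l (i / 2 ^ (k - l)) := by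
  have h2 : (0:ℤ) < 2 ^ (k - l) := by positivity
  have a1 := Int.mul_ediv_self_le (x := i) (k := 2 ^ (k-l)) h2.ne'
  have a2 := Int.lt_mul_ediv_self_add (x := i) (k := 2 ^ (k-l)) h2
  set a := i / 2 ^ (k - l)
  have b1 : (2:ℝ) ^ (k - l) * a ≤ i := by exact_mod_cast a1
  have b2 : (i:ℝ) + 1 ≤ (2:ℝ) ^ (k - l) * a + 2 ^ (k - l) := by exact_mod_cast a2
  have e : (2:ℝ) ^ k = 2 ^ l * 2 ^ (k - l) := by rw [← pow_add]; congr 1; omega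
  have p1 : (0:ℝ) < 2 ^ l := by positivity
  have p2 : (0:ℝ) < 2 ^ (k - l) := by positivity
  intro y hy
  unfold cDy at hy ⊢
  rw [mem_Icc, e, div_le_iff₀ (by positivity), le_div_iff₀ (by positivity)] at hy
  rw [mem_Icc, div_le_iff₀ (by positivity), le_div_iff₀ (by positivity)]
  constructor
  · by_contra hh
    push Not at hh
    nlinarith [mul_lt_mul_of_pos_left hh p2]
  · by_contra hh
    push Not at hh
    nlinarith [mul_lt_mul_of_pos_left hh p2]

lemma exists_level {t : ℝ} (ht : 0 < t) {d e : ℝ} (hd : 0 ≤ d) (hd1 : d ≤ 1) (he : 0 < e) :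
    ∃ l : ℕ, d ≤ 1 / 2 ^ l ∧ (2:ℝ) ^ (-(l:ℝ) * t) ≤ 2 ^ t * d ^ t + e := by
  rcases hd.eq_or_lt with h | h
  · subst h
    have h1 : Tendsto (fun l : ℕ => ((2:ℝ) ^ (-t)) ^ l) atTop (nhds 0) := by
      apply tendsto_pow_atTop_nhds_zero_of_lt_one (by positivity)
      exact Real.rpow_lt_one_of_one_lt_of_neg (by norm_num) (by linarith)
    obtain ⟨l, hl⟩ := (h1.eventually (gt_mem_nhds he)).exists
    refine ⟨l, by positivity, ?_⟩
    rw [Real.zero_rpow ht.ne', mul_zero, zero_add, neg_mul, mul_comm, ← neg_mul,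
      Real.rpow_mul (by norm_num), Real.rpow_natCast]
    exact hl.le
  · obtain ⟨n, h1, h2⟩ := exists_nat_pow_near_of_lt_one h hd1 (y := (1/2:ℝ)) (by norm_num) (by norm_num)
    refine ⟨n, by rwa [one_div_pow] at h2, ?_⟩
    have : (2:ℝ) ^ (-(n:ℝ) * t) ≤ 2 ^ t * d ^ t := by
      rw [← Real.mul_rpow (by norm_num) hd, Real.rpow_mul (by norm_num)]
      apply Real.rpow_le_rpow (by positivity) _ ht.le
      rw [Real.rpow_neg (by norm_num), Real.rpow_natCast, ← one_div, ← one_div_pow]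
      rw [pow_succ] at h1; linarith
    linarith

lemma dim_lower {T : ℝ → ℝ} {x : ℝ} {r : ℕ → ℝ} {t t2 : ℝ} (ht : 0 < t) (ht2 : t ≤ t2)
    {Node Vis : ℕ → ℤ → Prop} (hs : ∀ κ i, Node κ i → StepProp t t2 Node Vis κ i)
    {κ0 : ℕ} {i0 : ℤ} (h0 : Node κ0 i0) (hx : ∀ j, T^[j] x ∈ Icc (0:ℝ) 1) {N : ℕ → ℕ}
    (hN : Tendsto N atTop atTop)
    (hVis : ∀ κ i, Vis κ i → ∃ j, N κ ≤ j ∧ T^[j] x ∈ Dy κ i ∧ 1 / (2:ℝ) ^ κ < r j) :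
    ENNReal.ofReal t ≤ dimH (hitSet T x r) := by
  by_contra hlt
  push Not at hlt
  have hz : Measure.hausdorffMeasure t (hitSet T x r) = 0 := by
    have := hausdorffMeasure_of_dimH_lt (d := t.toNNReal) hlt
    rwa [Real.coe_toNNReal _ ht.le] at this
  rw [Measure.hausdorffMeasure_apply] at hz
  have hz1 := (ENNReal.iSup_eq_zero.1 (ENNReal.iSup_eq_zero.1 hz 1)) one_pos
  set d0 : ℝ := (2:ℝ) ^ (-(κ0 : ℝ) * t2) with hd0
  have hd0p : 0 < d0 := by positivity
  have hp2 : (0:ℝ) < 2 ^ t := by positivity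
  have hlt2 : (0:ENNReal) < ENNReal.ofReal (d0 / (16 * 2 ^ t)) := by simp; positivity
  rw [← hz1] at hlt2
  simp only [iInf_lt_iff] at hlt2
  obtain ⟨U, hU, hUd, hUs⟩ := hlt2
  have hE : (0:ENNReal) < ENNReal.ofReal (d0 / 16) := by simp; positivity
  obtain ⟨ε, hε, hεs⟩ := ENNReal.exists_pos_sum_of_countable hE.ne' ℕ
  have hlevel : ∀ n, ∃ l : ℕ, ∃ p : ℝ, (∀ y ∈ U n, |y - p| ≤ 1 / 2 ^ l) ∧
      ENNReal.ofReal ((2:ℝ) ^ (-(l:ℝ) * t)) ≤ 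
        ENNReal.ofReal (2 ^ t) * (⨆ _ : (U n).Nonempty, Metric.ediam (U n) ^ t) + ε n := by
    intro n
    have hεn : (0:ℝ) < ε n := by exact_mod_cast hε n
    rcases (U n).eq_empty_or_nonempty with h | h
    · obtain ⟨l, -, h2⟩ := exists_level ht le_rfl zero_le_one hεn
      refine ⟨l, 0, by simp [h], ?_⟩
      rw [Real.zero_rpow ht.ne', mul_zero, zero_add] at h2
      refine le_trans ?_ le_add_self
      rw [← ENNReal.ofReal_coe_nnreal]
      exact ENNReal.ofReal_le_ofReal h2
    · have htop : Metric.ediam (U n) ≠ ⊤ := ((hUd n).trans_lt ENNReal.one_lt_top).ne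
      obtain ⟨l, h1, h2⟩ := exists_level ht (d := (Metric.ediam (U n)).toReal) ENNReal.toReal_nonneg
        (ENNReal.toReal_le_of_le_ofReal zero_le_one (by simpa using hUd n)) hεn
      obtain ⟨p, hp⟩ := h
      refine ⟨l, p, ?_, ?_⟩
      · intro y hy
        refine le_trans ?_ h1
        have := Metric.edist_le_ediam_of_mem hy hp
        rw [← Real.dist_eq, dist_edist]
        exact ENNReal.toReal_mono htop this
      · have hne : (U n).Nonempty := ⟨p, hp⟩
        rw [iSup_pos hne]
        refine (ENNReal.ofReal_le_ofReal h2).trans ?_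
        rw [ENNReal.ofReal_add (by positivity) hεn.le, ENNReal.ofReal_coe_nnreal, 
          ENNReal.ofReal_mul (by positivity), ← ENNReal.ofReal_rpow_of_nonneg ENNReal.toReal_nonneg ht.le, ENNReal.ofReal_toReal htop]
  choose lv pt hpt hlv using hlevel
  let e := Nat.divModEquiv 4
  have hcost : ∑' m, ENNReal.ofReal ((2:ℝ) ^ (-(lv (e m).1 : ℝ) * t)) < ENNReal.ofReal ((2:ℝ) ^ (-(κ0 : ℝ) * t2)) := by
    rw [e.tsum_eq (fun q : ℕ × Fin 4 => ENNReal.ofReal ((2:ℝ) ^ (-(lv q.1 : ℝ) * t))), ENNReal.tsum_prod']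
    calc ∑' n, ∑' _ : Fin 4, ENNReal.ofReal ((2:ℝ) ^ (-(lv n : ℝ) * t))
        = 4 * ∑' n, ENNReal.ofReal ((2:ℝ) ^ (-(lv n : ℝ) * t)) := by
          rw [← ENNReal.tsum_mul_left]; congr 1; funext n; rw [tsum_fintype]; simp
      _ ≤ 4 * ∑' n, (ENNReal.ofReal (2 ^ t) * (⨆ _ : (U n).Nonempty, Metric.ediam (U n) ^ t) + ε n) := by
          gcongr with n; exact hlv n
      _ = 4 * (ENNReal.ofReal (2 ^ t) * (∑' n, ⨆ _ : (U n).Nonempty, Metric.ediam (U n) ^ t) + ∑' n, (ε n : ENNReal)) := by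
          rw [ENNReal.tsum_add, ENNReal.tsum_mul_left]
      _ ≤ 4 * (ENNReal.ofReal (2 ^ t) * ENNReal.ofReal (d0 / (16 * 2 ^ t)) + ENNReal.ofReal (d0 / 16)) := by
          gcongr
      _ = ENNReal.ofReal (d0 / 2) := by
          rw [← ENNReal.ofReal_mul (by positivity), ← ENNReal.ofReal_add (by positivity) (by positivity)]
          rw [show (4:ENNReal) = ENNReal.ofReal 4 by simp, ← ENNReal.ofReal_mul (by positivity)]
          congr 1; field_simp; norm_num
      _ < ENNReal.ofReal d0 := by
          rw [ENNReal.ofReal_lt_ofReal_iff hd0p]; linarith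
  obtain ⟨κs, is, hmono, hanc, hv, hav⟩ := branch ht ht2 hs (lev := fun m => lv (e m).1)
    (ind := fun m => idx (lv (e m).1) (pt (e m).1) - 2 + ((e m).2 : ℕ)) h0 hcost
  -- limit point
  have hle : ∀ n, ((is n : ℝ)) / 2 ^ (κs n) ≤ ((is n : ℝ) + 1) / 2 ^ (κs n) := by
    intro n; gcongr; linarith
  have hnest : Antitone fun n => Icc ((is n : ℝ) / 2 ^ (κs n)) (((is n : ℝ) + 1) / 2 ^ (κs n)) := by
    apply antitone_nat_of_succ_le
    intro n
    have := cDy_subset (hmono (Nat.lt_succ_self n)).le (is (n+1))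
    rw [Nat.succ_eq_add_one, hanc n] at this
    exact this
  have hy := ciSup_mem_iInter_Icc_of_antitone_Icc hnest hle
  set y := ⨆ n, ((is n : ℝ)) / 2 ^ (κs n)
  have hyc : ∀ n, y ∈ cDy (κs n) (is n) := fun n => mem_iInter.1 hy n
  have hκt : Tendsto κs atTop atTop := hmono.tendsto_atTop
  have hclose : ∀ n, ∃ j, N (κs (n+1)) ≤ j ∧ |T^[j] x - y| ≤ 1 / 2 ^ κs (n+1) ∧ 1 / (2:ℝ) ^ κs (n+1) < r j := by
    intro n
    obtain ⟨j, h1, h2, h3⟩ := hVis _ _ (hv n)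
    refine ⟨j, h1, ?_, h3⟩
    rw [mem_Dy_iff] at h2
    have := hyc (n+1)
    unfold cDy at this
    rw [mem_Icc, add_div] at this
    rw [add_div] at h2
    rw [abs_le]
    constructor <;> linarith [this.1, this.2, h2.1, h2.2]
  have hy01 : y ∈ Icc (0:ℝ) 1 := by
    choose j hj1 hj2 hj3 using hclose
    have : Tendsto (fun n => T^[j n] x) atTop (nhds y) := by
      rw [tendsto_iff_dist_tendsto_zero]
      have h4 : Tendsto (fun n => 1 / (2:ℝ) ^ κs (n+1)) atTop (nhds 0) := by
        have := (tendsto_pow_atTop_nhds_zero_of_lt_one (r := (1/2:ℝ)) (by norm_num) (by norm_num)).comp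
          (hκt.comp (tendsto_add_atTop_nat 1))
        refine this.congr (fun n => ?_)
        simp
      exact squeeze_zero (fun _ => dist_nonneg) (fun n => hj2 n) h4
    exact isClosed_Icc.mem_of_tendsto this (Eventually.of_forall fun n => hx _)
  have hyhit : y ∈ hitSet T x r := by
    refine ⟨hy01, ?_⟩
    rw [frequently_atTop]
    intro a
    obtain ⟨n, hn⟩ := ((hN.comp (hκt.comp (tendsto_add_atTop_nat 1))).eventually_ge_atTop a).exists
    obtain ⟨j, h1, h2, h3⟩ := hclose n
    exact ⟨j, le_trans hn h1, h2.trans_lt h3⟩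
  obtain ⟨m, hm⟩ := mem_iUnion.1 (hU hyhit)
  have hyp := hpt m y hm
  obtain ⟨n, hn⟩ := (hκt.eventually_gt_atTop (lv m)).exists
  have hyc2 := cDy_subset hn.le (is n) (hyc n)
  set i' := is n / 2 ^ (κs n - lv m) with hi'
  have hp : pt m ∈ Dy (lv m) (idx (lv m) (pt m)) := rfl
  rw [mem_Dy_iff] at hp
  unfold cDy at hyc2
  have p0 : (0:ℝ) < 2 ^ lv m := by positivity
  rw [mem_Icc, div_le_iff₀ p0, le_div_iff₀ p0] at hyc2
  rw [div_le_iff₀ p0, lt_div_iff₀ p0] at hp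
  rw [le_div_iff₀ p0] at hyp
  have q1 : (y - pt m) * 2 ^ lv m ≤ 1 := le_trans (by gcongr; exact le_abs_self _) hyp
  have q2 : -(y - pt m) * 2 ^ lv m ≤ 1 := le_trans (by gcongr; exact neg_le_abs _) hyp
  have r1 : (i' : ℝ) < idx (lv m) (pt m) + 2 := by linarith [hyc2.1, hp.2]
  have r2 : (idx (lv m) (pt m) : ℝ) - 2 ≤ i' := by linarith [hyc2.2, hp.1]
  have r1' : i' < idx (lv m) (pt m) + 2 := by exact_mod_cast r1
  have r2' : idx (lv m) (pt m) - 2 ≤ i' := by exact_mod_cast r2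
  set D := (i' - (idx (lv m) (pt m) - 2)).toNat with hD
  have hD4 : D < 4 := by omega
  have := hav n (e.symm (m, ⟨D, hD4⟩))
  simp only [Equiv.apply_symm_apply] at this
  apply this hn
  rw [← hi']; omega

structure Sys (T : ℝ → ℝ) (μ : Measure ℝ) (p : ℕ → ℝ) : Prop where
  maps : Set.MapsTo T (Set.Icc (0:ℝ) 1) (Set.Icc (0:ℝ) 1)
  meas : Measurable T
  prob : IsProbabilityMeasure μ
  supp : μ (Set.Icc (0:ℝ) 1)ᶜ = 0
  inv : μ.map T = μ
  ppos : ∀ n, 0 < p n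
  psum : Summable p
  decay : ∀ f g : ℝ → ℝ, Integrable f μ → BoundedVariationOn g (Set.Icc (0:ℝ) 1) →
      ∀ n : ℕ,
        |(∫ x, f (T^[n] x) * g x ∂μ) - (∫ x, f x ∂μ) * (∫ x, g x ∂μ)| ≤
          (∫ x, |f x| ∂μ) *
            ((∫ x, |g x| ∂μ) + (eVariationOn g (Set.Icc (0:ℝ) 1)).toReal) * p n

lemma Sys.mp {T : ℝ → ℝ} {μ : Measure ℝ} {p : ℕ → ℝ} (S : Sys T μ p) (n : ℕ) :
    MeasurePreserving T^[n] μ μ :=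
  MeasurePreserving.iterate ⟨S.meas, S.inv⟩ n

lemma Sys.aeI {T : ℝ → ℝ} {μ : Measure ℝ} {p : ℕ → ℝ} (S : Sys T μ p) :
    ∀ᵐ x ∂μ, x ∈ Icc (0:ℝ) 1 := S.supp

noncomputable def ind1 (B : Set ℝ) : ℝ → ℝ := B.indicator (fun _ => (1:ℝ))

lemma ind1_nonneg (B : Set ℝ) (x : ℝ) : 0 ≤ ind1 B x := indicator_nonneg (fun _ _ => zero_le_one) x
lemma ind1_le (B : Set ℝ) (x : ℝ) : ind1 B x ≤ 1 := indicator_le_self' (fun _ _ => zero_le_one) x |>.trans le_rfl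

lemma ind1_meas {B : Set ℝ} (hB : MeasurableSet B) : Measurable (ind1 B) := measurable_const.indicator hB

noncomputable def Av (T : ℝ → ℝ) (N : ℕ) (B : Set ℝ) (x : ℝ) : ℝ :=
  (N:ℝ)⁻¹ * ∑ j ∈ Finset.Ico N (2 * N), ind1 B (T^[j] x)

lemma Av_nonneg (T : ℝ → ℝ) (N : ℕ) (B : Set ℝ) (x : ℝ) : 0 ≤ Av T N B x :=
  mul_nonneg (by positivity) (Finset.sum_nonneg fun _ _ => ind1_nonneg _ _)

lemma Av_le_one (T : ℝ → ℝ) (N : ℕ) (B : Set ℝ) (x : ℝ) : Av T N B x ≤ 1 := by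
  unfold Av
  rcases Nat.eq_zero_or_pos N with h | h
  · simp [h]
  have : ∑ j ∈ Finset.Ico N (2 * N), ind1 B (T^[j] x) ≤ ∑ j ∈ Finset.Ico N (2 * N), (1:ℝ) :=
    Finset.sum_le_sum fun _ _ => ind1_le _ _
  rw [Finset.sum_const, Nat.card_Ico, nsmul_eq_mul, mul_one, show 2 * N - N = N by omega] at this
  have hN : (0:ℝ) < N := by exact_mod_cast h
  rw [inv_mul_le_iff₀ hN]; linarith

section
variable {T : ℝ → ℝ} {μ : Measure ℝ} {p : ℕ → ℝ}

lemma Sys.ind_int (S : Sys T μ p) {B : Set ℝ} (hB : MeasurableSet B) : Integrable (ind1 B) μ := by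
  have := S.prob
  exact (integrable_const (1:ℝ)).indicator hB

lemma Sys.ind_integral (S : Sys T μ p) {B : Set ℝ} (hB : MeasurableSet B) :
    ∫ x, ind1 B x ∂μ = μ.real B := by
  unfold ind1; exact integral_indicator_one hB

lemma Sys.Av_meas (S : Sys T μ p) (N : ℕ) {B : Set ℝ} (hB : MeasurableSet B) : Measurable (Av T N B) := by
  unfold Av
  apply Measurable.const_mul
  apply Finset.measurable_sum
  intro j _
  exact (ind1_meas hB).comp (S.mp j).measurable

lemma Sys.bdd_int (S : Sys T μ p) {f : ℝ → ℝ} (hf : Measurable f) (C : ℝ) (hC : ∀ x, |f x| ≤ C) :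
    Integrable f μ := by
  have := S.prob
  exact Integrable.of_bound hf.aestronglyMeasurable C (Eventually.of_forall hC)

lemma Sys.cov (S : Sys T μ p) {B : Set ℝ} (hB : MeasurableSet B)
    (hv : eVariationOn (ind1 B) (Icc 0 1) ≤ 2) {i j : ℕ} (h : i ≤ j) :
    ∫ x, (ind1 B (T^[j] x) - μ.real B) * (ind1 B (T^[i] x) - μ.real B) ∂μ ≤ 3 * μ.real B * p (j - i) := by
  have := S.prob
  set m := μ.real B with hm
  have hm0 : 0 ≤ m := measureReal_nonneg
  have hm1 : m ≤ 1 := measureReal_le_one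
  have h1 : ∫ x, (ind1 B (T^[j] x) - m) * (ind1 B (T^[i] x) - m) ∂μ =
      ∫ x, (ind1 B (T^[j-i] x) - m) * (ind1 B x - m) ∂μ := by
    have := integral_map (μ := μ) (φ := T^[i]) (S.mp i).measurable.aemeasurable 
      (f := fun x => (ind1 B (T^[j-i] x) - m) * (ind1 B x - m)) (by
        apply Measurable.aestronglyMeasurable
        exact (((ind1_meas hB).comp (S.mp _).measurable).sub_const _).mul ((ind1_meas hB).sub_const _))
    rw [(S.mp i).map_eq] at this
    rw [this]
    congr 1; funext x
    rw [← Function.iterate_add_apply, Nat.sub_add_cancel h]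
  rw [h1]
  have ib := S.ind_int hB
  have ib2 : Integrable (fun x => ind1 B (T^[j-i] x)) μ := (S.mp (j-i)).integrable_comp_of_integrable ib
  have ib3 : Integrable (fun x => ind1 B (T^[j-i] x) * ind1 B x) μ := by
    apply S.bdd_int (((ind1_meas hB).comp (S.mp _).measurable).mul (ind1_meas hB)) 1
    intro x
    show |ind1 B (T^[j-i] x) * ind1 B x| ≤ 1
    rw [abs_mul, abs_of_nonneg (ind1_nonneg _ _), abs_of_nonneg (ind1_nonneg _ _)]
    exact mul_le_one₀ (ind1_le _ _) (ind1_nonneg _ _) (ind1_le _ _)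
  have e2 : ∫ x, ind1 B (T^[j-i] x) ∂μ = m := by
    have := integral_map (μ := μ) (φ := T^[j-i]) (S.mp _).measurable.aemeasurable 
      (f := ind1 B) (ind1_meas hB).aestronglyMeasurable
    rw [(S.mp _).map_eq, S.ind_integral hB] at this
    exact this.symm
  have h2 : ∫ x, (ind1 B (T^[j-i] x) - m) * (ind1 B x - m) ∂μ = 
      ∫ x, ind1 B (T^[j-i] x) * ind1 B x ∂μ - m * m := by
    have : (fun x => (ind1 B (T^[j-i] x) - m) * (ind1 B x - m)) = fun x => 
      (ind1 B (T^[j-i] x) * ind1 B x) - m * ind1 B (T^[j-i] x) - m * ind1 B x + m * m := by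
      funext x; ring
    have j1 : Integrable (fun x => ind1 B (T^[j-i] x) * ind1 B x - m * ind1 B (T^[j-i] x)) μ := ib3.sub (ib2.const_mul m)
    have j2 : Integrable (fun x => ind1 B (T^[j-i] x) * ind1 B x - m * ind1 B (T^[j-i] x) - m * ind1 B x) μ := j1.sub (ib.const_mul m)
    rw [this, integral_add j2 (integrable_const _),
      integral_sub j1 (ib.const_mul m), integral_sub ib3 (ib2.const_mul m),
      integral_const_mul, integral_const_mul, e2, S.ind_integral hB]
    simp
    rw [← hm]; ring
  rw [h2]
  have h3 := S.decay (ind1 B) (ind1 B) ib (ne_top_of_le_ne_top (by simp) hv) (j - i)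
  simp only [abs_of_nonneg (ind1_nonneg _ _), S.ind_integral hB] at h3
  rw [← hm] at h3
  refine (le_abs_self _).trans (h3.trans ?_)
  have h4 : (eVariationOn (ind1 B) (Icc 0 1)).toReal ≤ 2 := by
    have := ENNReal.toReal_mono (by simp) hv
    simpa using this
  have := S.ppos (j - i)
  apply mul_le_mul_of_nonneg_right _ this.le
  nlinarith

lemma Sys.sum_p (S : Sys T μ p) (s : Finset ℕ) (i : ℕ) :
    ∑ j ∈ s, p ((j - i) + (i - j)) ≤ 2 * ∑' n, p n := by
  have hnn : ∀ n, 0 ≤ p n := fun n => (S.ppos n).le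
  rw [← Finset.sum_filter_add_sum_filter_not s (fun j => i ≤ j), two_mul]
  apply add_le_add
  · rw [← Finset.sum_image (f := p) (s := s.filter (fun j => i ≤ j)) (g := fun j => (j - i) + (i - j))]
    · exact S.psum.sum_le_tsum _ (fun n _ => hnn n)
    · intro a ha b hb hab
      have := (Finset.mem_filter.1 ha).2
      have := (Finset.mem_filter.1 hb).2
      dsimp at hab; omega
  · rw [← Finset.sum_image (f := p) (s := s.filter (fun j => ¬ i ≤ j)) (g := fun j => (j - i) + (i - j))]
    · exact S.psum.sum_le_tsum _ (fun n _ => hnn n)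
    · intro a ha b hb hab
      have := (Finset.mem_filter.1 ha).2
      have := (Finset.mem_filter.1 hb).2
      dsimp at hab; omega

lemma Sys.variance (S : Sys T μ p) {B : Set ℝ} (hB : MeasurableSet B)
    (hv : eVariationOn (ind1 B) (Icc 0 1) ≤ 2) {N : ℕ} (hN : 0 < N) :
    ∫ x, (Av T N B x - μ.real B) ^ 2 ∂μ ≤ 6 * μ.real B * (∑' n, p n) / N := by
  have := S.prob
  set m := μ.real B with hm
  have hm0 : 0 ≤ m := measureReal_nonneg
  have hm1 : m ≤ 1 := measureReal_le_one
  have hNr : (0:ℝ) < N := by exact_mod_cast hN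
  set I := Finset.Ico N (2 * N)
  have hcard : I.card = N := by simp [I]; omega
  have e1 : ∀ x, (Av T N B x - m) ^ 2 = (N:ℝ)⁻¹ ^ 2 * ∑ i ∈ I, ∑ j ∈ I, 
      (ind1 B (T^[j] x) - m) * (ind1 B (T^[i] x) - m) := by
    intro x
    have : Av T N B x - m = (N:ℝ)⁻¹ * ∑ j ∈ I, (ind1 B (T^[j] x) - m) := by
      rw [Finset.sum_sub_distrib, Finset.sum_const, hcard, mul_sub]
      unfold Av; simp; field_simp; rfl
    rw [this, mul_pow, sq (∑ j ∈ I, (ind1 B (T^[j] x) - m)), Finset.sum_mul_sum]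
    congr 1
    apply Finset.sum_congr rfl; intro i _
    apply Finset.sum_congr rfl; intro j _; ring
  have hint : ∀ i j, Integrable (fun x => (ind1 B (T^[j] x) - m) * (ind1 B (T^[i] x) - m)) μ := by
    intro i j
    apply S.bdd_int _ 1
    · intro x
      rw [abs_mul]
      have a1 : ∀ z, |ind1 B z - m| ≤ 1 := by
        intro z; rw [abs_le]; constructor <;> linarith [ind1_nonneg B z, ind1_le B z]
      exact mul_le_one₀ (a1 _) (abs_nonneg _) (a1 _)
    · exact (((ind1_meas hB).comp (S.mp _).measurable).sub_const _).mul
        (((ind1_meas hB).comp (S.mp _).measurable).sub_const _)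
  simp_rw [e1]
  rw [integral_const_mul, integral_finsetSum _ (fun i _ => integrable_finsetSum _ (fun j _ => hint i j))]
  have hb : ∀ i ∈ I, ∫ x, ∑ j ∈ I, (ind1 B (T^[j] x) - m) * (ind1 B (T^[i] x) - m) ∂μ ≤ 6 * m * ∑' n, p n := by
    intro i _
    rw [integral_finsetSum _ (fun j _ => hint i j)]
    have : ∀ j ∈ I, ∫ x, (ind1 B (T^[j] x) - m) * (ind1 B (T^[i] x) - m) ∂μ ≤ 3 * m * p ((j - i) + (i - j)) := by
      intro j _
      rcases le_total i j with h | h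
      · have := S.cov hB hv h
        rwa [Nat.sub_eq_zero_of_le h, add_zero]
      · have := S.cov hB hv h
        rw [Nat.sub_eq_zero_of_le h, zero_add]
        simp_rw [mul_comm (ind1 B (T^[j] _) - m)]
        exact this
    refine (Finset.sum_le_sum this).trans ?_
    rw [← Finset.mul_sum]
    nlinarith [S.sum_p I i]
  refine (mul_le_mul_of_nonneg_left (Finset.sum_le_sum hb) (by positivity)).trans ?_
  rw [Finset.sum_const, hcard, nsmul_eq_mul]
  apply le_of_eq; field_simp

lemma var_Dy (l : ℕ) (i : ℤ) : eVariationOn (ind1 (Dy l i)) (Icc 0 1) ≤ 2 := by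
  rw [Dy_eq]; apply var_ind
  gcongr; linarith

lemma Sys.sum_Dy_le (S : Sys T μ p) (l : ℕ) (s : Finset ℤ) : ∑ i ∈ s, μ.real (Dy l i) ≤ 1 := by
  have := S.prob
  rw [← measureReal_biUnion_finset (fun i _ j _ h => Dy_disj l h) (fun i _ => measurableSet_Dy l i)]
  exact measureReal_le_one

noncomputable def Xv (T : ℝ → ℝ) (μ : Measure ℝ) (t3 : ℝ) (N : ℕ) (κ : ℕ) (x : ℝ) : ℝ :=
  ∑ l ∈ Finset.range (κ + 1), (2:ℝ) ^ ((l:ℝ) * t3) * 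
    ∑ i ∈ Finset.Icc (0:ℤ) (2 ^ l), (Av T N (Dy l i) x - μ.real (Dy l i)) ^ 2

lemma Xv_nonneg (T : ℝ → ℝ) (μ : Measure ℝ) (t3 : ℝ) (N : ℕ) (κ : ℕ) (x : ℝ) : 0 ≤ Xv T μ t3 N κ x :=
  Finset.sum_nonneg fun _ _ => mul_nonneg (by positivity) (Finset.sum_nonneg fun _ _ => sq_nonneg _)

lemma Sys.dev_int (S : Sys T μ p) (N l : ℕ) (i : ℤ) : 
    Integrable (fun x => (Av T N (Dy l i) x - μ.real (Dy l i)) ^ 2) μ := by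
  have := S.prob
  apply S.bdd_int (((S.Av_meas N (measurableSet_Dy l i)).sub_const _).pow_const 2) 1
  intro x
  rw [abs_pow, sq_le_one_iff₀ (abs_nonneg _), abs_le]
  have h1 : μ.real (Dy l i) ≤ 1 := measureReal_le_one
  have h0 : 0 ≤ μ.real (Dy l i) := measureReal_nonneg
  constructor <;> linarith [Av_nonneg T N (Dy l i) x, Av_le_one T N (Dy l i) x]

lemma Sys.Xv_int (S : Sys T μ p) (t3 : ℝ) (N κ : ℕ) : Integrable (Xv T μ t3 N κ) μ := by
  unfold Xv
  exact integrable_finsetSum _ fun l _ => (integrable_finsetSum _ fun i _ => S.dev_int N l i).const_mul _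

lemma Sys.Xv_le (S : Sys T μ p) {t3 : ℝ} (ht3 : 0 ≤ t3) {N : ℕ} (hN : 0 < N) (κ : ℕ) :
    ∫ x, Xv T μ t3 N κ x ∂μ ≤ ((κ:ℝ) + 1) * (2:ℝ) ^ ((κ:ℝ) * t3) * (6 * (∑' n, p n) / N) := by
  unfold Xv
  have hP : 0 ≤ ∑' n, p n := tsum_nonneg fun n => (S.ppos n).le
  rw [integral_finsetSum _ fun l _ => (integrable_finsetSum _ fun i _ => S.dev_int N l i).const_mul _]
  have : ∀ l ∈ Finset.range (κ + 1), ∫ x, (2:ℝ) ^ ((l:ℝ) * t3) * 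
    ∑ i ∈ Finset.Icc (0:ℤ) (2 ^ l), (Av T N (Dy l i) x - μ.real (Dy l i)) ^ 2 ∂μ ≤ 
      (2:ℝ) ^ ((κ:ℝ) * t3) * (6 * (∑' n, p n) / N) := by
    intro l hl
    rw [integral_const_mul, integral_finsetSum _ fun i _ => S.dev_int N l i]
    apply mul_le_mul
    · apply Real.rpow_le_rpow_of_exponent_le (by norm_num)
      have : (l:ℝ) ≤ κ := by exact_mod_cast Nat.lt_succ_iff.1 (Finset.mem_range.1 hl)
      nlinarith
    · refine (Finset.sum_le_sum fun i _ => S.variance (measurableSet_Dy l i) (var_Dy l i) hN).trans ?_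
      have e : ∀ i, 6 * μ.real (Dy l i) * (∑' n, p n) / N = (6 * (∑' n, p n) / N) * μ.real (Dy l i) := by
        intro i; ring
      simp_rw [e]
      rw [← Finset.mul_sum]
      exact mul_le_of_le_one_right (by positivity) (S.sum_Dy_le l _)
    · exact Finset.sum_nonneg fun i _ => integral_nonneg fun x => sq_nonneg _
    · positivity
  refine (Finset.sum_le_sum this).trans ?_
  rw [Finset.sum_const, Finset.card_range, nsmul_eq_mul]
  push_cast
  apply le_of_eq; ring

lemma ae_tendsto_of_summable {f : ℕ → ℝ → ℝ} (hf : ∀ n, Integrable (f n) μ) (h0 : ∀ n x, 0 ≤ f n x)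
    (hs : Summable fun n => ∫ x, f n x ∂μ) : ∀ᵐ x ∂μ, Tendsto (fun n => f n x) atTop (nhds 0) := by
  have h1 : ∫⁻ x, ∑' n, ENNReal.ofReal (f n x) ∂μ ≠ ⊤ := by
    rw [lintegral_tsum fun n => (hf n).aestronglyMeasurable.aemeasurable.ennreal_ofReal]
    have : ∀ n, ∫⁻ x, ENNReal.ofReal (f n x) ∂μ = ENNReal.ofReal (∫ x, f n x ∂μ) := fun n =>
      (ofReal_integral_eq_lintegral_ofReal (hf n) (Eventually.of_forall (h0 n))).symm
    simp_rw [this]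
    exact hs.tsum_ofReal_ne_top
  have h2 := ae_lt_top' (AEMeasurable.tsum fun n => (hf n).aestronglyMeasurable.aemeasurable.ennreal_ofReal) h1
  filter_upwards [h2] with x hx
  have h3 := ENNReal.tendsto_atTop_zero_of_tsum_ne_top hx.ne
  have h4 := (ENNReal.tendsto_toReal ENNReal.zero_ne_top).comp h3
  simpa [Function.comp_def, ENNReal.toReal_ofReal (h0 _ x)] using h4

lemma Sys.Xv_tendsto (S : Sys T μ p) {t3 ε : ℝ} (ht3 : 0 ≤ t3) (hε : 0 < ε) {N : ℕ → ℕ} 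
    (hN : ∀ κ : ℕ, (2:ℝ) ^ ((κ:ℝ) * (t3 + ε)) ≤ 4 * N κ) : 
    ∀ᵐ x ∂μ, Tendsto (fun κ => Xv T μ t3 (N κ) κ x) atTop (nhds 0) := by
  apply ae_tendsto_of_summable (fun κ => S.Xv_int _ _ _) (fun κ x => Xv_nonneg _ _ _ _ _ _)
  set P := ∑' n, p n
  have hP : 0 ≤ P := tsum_nonneg fun n => (S.ppos n).le
  set ρ : ℝ := (2:ℝ) ^ (-ε) with hρ
  have hρ0 : 0 < ρ := by positivity
  have hρ1 : ρ < 1 := Real.rpow_lt_one_of_one_lt_of_neg (by norm_num) (by linarith)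
  have hsum : Summable fun κ : ℕ => 24 * P * (((κ:ℝ) + 1) * ρ ^ κ) := by
    apply Summable.mul_left
    have h1 := summable_pow_mul_geometric_of_norm_lt_one 1 (r := ρ) (by rwa [Real.norm_of_nonneg hρ0.le])
    have h2 := summable_geometric_of_lt_one hρ0.le hρ1
    refine (h1.add h2).congr fun κ => ?_
    ring
  refine Summable.of_nonneg_of_le (fun κ => integral_nonneg fun x => Xv_nonneg _ _ _ _ _ _) (fun κ => ?_) hsum
  have hNp : (0:ℝ) < N κ := by
    have : (0:ℝ) < (2:ℝ) ^ ((κ:ℝ) * (t3 + ε)) := by positivity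
    linarith [hN κ]
  refine (S.Xv_le ht3 (by exact_mod_cast hNp) κ).trans ?_
  have h1 : (2:ℝ) ^ ((κ:ℝ) * t3) = 2 ^ ((κ:ℝ) * (t3 + ε)) * ρ ^ κ := by
    rw [hρ, ← Real.rpow_natCast, ← Real.rpow_mul (by norm_num), ← Real.rpow_add (by norm_num)]
    congr 1; ring
  rw [h1]
  have h2 : 2 ^ ((κ:ℝ) * (t3 + ε)) * (6 * P / N κ) ≤ 24 * P := by
    rw [← mul_div_assoc, div_le_iff₀ hNp]
    nlinarith [hN κ]
  calc ((κ:ℝ) + 1) * (2 ^ ((κ:ℝ) * (t3 + ε)) * ρ ^ κ) * (6 * P / N κ) 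
      = (((κ:ℝ) + 1) * ρ ^ κ) * (2 ^ ((κ:ℝ) * (t3 + ε)) * (6 * P / N κ)) := by ring
    _ ≤ (((κ:ℝ) + 1) * ρ ^ κ) * (24 * P) := by gcongr
    _ = _ := by ring
end

section
variable {T : ℝ → ℝ} {μ : Measure ℝ} {p : ℕ → ℝ}

lemma Sys.approx (S : Sys T μ p) {Bad : Set ℝ} (hB : MeasurableSet Bad) {δ : ℝ} (hδ : 0 < δ) :
    ∃ g : ℝ → ℝ, BoundedVariationOn g (Icc 0 1) ∧ Integrable g μ ∧ ∫ x, |ind1 Bad x - g x| ∂μ ≤ δ := by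
  have := S.prob
  obtain ⟨g0, -, h1, h2, h3⟩ := (S.ind_int hB).exists_hasCompactSupport_integral_sub_le (half_pos hδ)
  obtain ⟨q, hq⟩ := exists_polynomial_near_of_continuousOn 0 1 g0 h2.continuousOn (δ/2) (half_pos hδ)
  have hqi : Integrable (fun x => q.eval x) μ := by
    obtain ⟨C, hC⟩ := isCompact_Icc.exists_bound_of_continuousOn (s := Icc (0:ℝ) 1) q.continuous.continuousOn
    refine Integrable.of_bound q.continuous.measurable.aestronglyMeasurable C ?_
    filter_upwards [S.aeI] with x hx using hC x hx
  refine ⟨fun x => q.eval x, ?_, hqi, ?_⟩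
  · have hc : ContDiff ℝ 1 (fun x => q.eval x) := by
      simpa using q.contDiff_aeval (𝕜 := ℝ) 1
    obtain ⟨K, hK⟩ := (hc.locallyLipschitz.locallyLipschitzOn (s := Icc (0:ℝ) 1)).exists_lipschitzOnWith_of_compact isCompact_Icc
    have := hK.locallyBoundedVariationOn 0 1 (by simp) (by simp)
    rwa [inter_self] at this
  · have hi1 : Integrable (fun x => |ind1 Bad x - g0 x|) μ := ((S.ind_int hB).sub h3).abs
    calc ∫ x, |ind1 Bad x - q.eval x| ∂μ ≤ ∫ x, (|ind1 Bad x - g0 x| + δ/2) ∂μ := by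
          apply integral_mono_ae ((S.ind_int hB).sub hqi).abs (hi1.add (integrable_const _))
          filter_upwards [S.aeI] with x hx
          have := (hq x hx).le
          have h4 := abs_sub_le (ind1 Bad x) (g0 x) (q.eval x)
          rw [abs_sub_comm (g0 x)] at h4
          show |ind1 Bad x - q.eval x| ≤ |ind1 Bad x - g0 x| + δ/2
          linarith
      _ = ∫ x, |ind1 Bad x - g0 x| ∂μ + δ/2 := by
          rw [integral_add hi1 (integrable_const _)]; simp
      _ ≤ δ := by
          have : ∫ x, |ind1 Bad x - g0 x| ∂μ ≤ δ/2 := h1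
          linarith

lemma Sys.mixing (S : Sys T μ p) {Bad : Set ℝ} (hB : MeasurableSet Bad) {δ : ℝ} (hδ : 0 < δ) :
    ∃ N0 : ℕ, ∀ N ≥ N0, ∀ H : Set ℝ, MeasurableSet H →
      μ.real Bad * μ.real H - δ ≤ ∫ x, ind1 Bad x * Av T N H x ∂μ := by
  have := S.prob
  obtain ⟨g, hgv, hgi, hgd⟩ := S.approx hB (show 0 < δ/3 by linarith)
  set C := (∫ x, |g x| ∂μ) + (eVariationOn g (Icc (0:ℝ) 1)).toReal with hC
  have hC0 : 0 ≤ C := add_nonneg (integral_nonneg fun _ => abs_nonneg _) ENNReal.toReal_nonneg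
  set P := ∑' n, p n with hP
  have hP0 : 0 ≤ P := tsum_nonneg fun n => (S.ppos n).le
  obtain ⟨N0, hN0⟩ := exists_nat_gt (C * P / (δ/3))
  refine ⟨N0 + 1, fun N hN H hH => ?_⟩
  have hNr : (0:ℝ) < N := by exact_mod_cast (by omega : 0 < N)
  have hCP : (N:ℝ)⁻¹ * (C * P) ≤ δ/3 := by
    rw [div_lt_iff₀ (by linarith)] at hN0
    rw [inv_mul_le_iff₀ hNr]
    have : (N0:ℝ) ≤ N := by exact_mod_cast (by omega : N0 ≤ N)
    nlinarith
  have hAm := S.Av_meas N hH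
  have hA0 := Av_nonneg T N H
  have hA1 := Av_le_one T N H
  have hm0 : 0 ≤ μ.real H := measureReal_nonneg
  have hm1 : μ.real H ≤ 1 := measureReal_le_one
  have hAabs : ∀ x, ‖Av T N H x‖ ≤ 1 := fun x => by rw [Real.norm_of_nonneg (hA0 x)]; exact hA1 x
  have i1 : Integrable (fun x => ind1 Bad x * Av T N H x) μ :=
    (S.ind_int hB).mul_bdd (c := 1) hAm.aestronglyMeasurable (Eventually.of_forall hAabs)
  have i2 : Integrable (fun x => g x * Av T N H x) μ :=
    hgi.mul_bdd (c := 1) hAm.aestronglyMeasurable (Eventually.of_forall hAabs)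
  have hsub : Integrable (fun x => |ind1 Bad x - g x|) μ := ((S.ind_int hB).sub hgi).abs
  -- step 1
  have s1 : ∫ x, g x * Av T N H x ∂μ - δ/3 ≤ ∫ x, ind1 Bad x * Av T N H x ∂μ := by
    have : ∫ x, g x * Av T N H x ∂μ ≤ ∫ x, (ind1 Bad x * Av T N H x + |ind1 Bad x - g x|) ∂μ := by
      apply integral_mono i2 (i1.add hsub)
      intro x
      show g x * Av T N H x ≤ ind1 Bad x * Av T N H x + |ind1 Bad x - g x|
      have h4 := neg_le_abs (ind1 Bad x - g x)
      have h5 := abs_nonneg (ind1 Bad x - g x)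
      nlinarith [hA0 x, hA1 x]
    rw [integral_add i1 hsub] at this
    linarith
  -- step 3
  have s3 : μ.real Bad * μ.real H - δ/3 ≤ (∫ x, g x ∂μ) * μ.real H := by
    have : μ.real Bad - ∫ x, g x ∂μ ≤ δ/3 := by
      rw [← S.ind_integral hB, ← integral_sub (S.ind_int hB) hgi]
      exact (integral_mono ((S.ind_int hB).sub hgi) hsub fun x => le_abs_self _).trans hgd
    nlinarith
  -- step 2
  have s2 : (∫ x, g x ∂μ) * μ.real H - δ/3 ≤ ∫ x, g x * Av T N H x ∂μ := by
    have iterm : ∀ j, Integrable (fun x => ind1 H (T^[j] x) * g x) μ := by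
      intro j
      refine hgi.bdd_mul (c := 1) ((ind1_meas hH).comp (S.mp j).measurable).aestronglyMeasurable (Eventually.of_forall fun x => ?_)
      show ‖ind1 H (T^[j] x)‖ ≤ 1
      rw [Real.norm_of_nonneg (ind1_nonneg _ _)]; exact ind1_le _ _
    have e : ∫ x, g x * Av T N H x ∂μ = (N:ℝ)⁻¹ * ∑ j ∈ Finset.Ico N (2*N), ∫ x, ind1 H (T^[j] x) * g x ∂μ := by
      rw [← integral_finsetSum _ (fun j _ => iterm j), ← integral_const_mul]
      congr 1; funext x
      unfold Av
      rw [← Finset.sum_mul]; ring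
    have hj : ∀ j ∈ Finset.Ico N (2*N), (∫ x, g x ∂μ) * μ.real H - C * p j ≤ ∫ x, ind1 H (T^[j] x) * g x ∂μ := by
      intro j _
      have h := S.decay (ind1 H) g (S.ind_int hH) hgv j
      simp only [abs_of_nonneg (ind1_nonneg _ _), S.ind_integral hH] at h
      rw [← hC] at h
      have h1 := (abs_le.1 h).1
      have h2 : μ.real H * C * p j ≤ C * p j := by
        have := mul_nonneg hC0 (S.ppos j).le
        nlinarith
      linarith
    have hsum := Finset.sum_le_sum hj
    rw [Finset.sum_sub_distrib, Finset.sum_const, Nat.card_Ico, show 2 * N - N = N by omega, nsmul_eq_mul,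
      ← Finset.mul_sum] at hsum
    have hp : ∑ j ∈ Finset.Ico N (2*N), p j ≤ P := S.psum.sum_le_tsum _ (fun n _ => (S.ppos n).le)
    rw [e]
    have := mul_le_mul_of_nonneg_left hsum (inv_nonneg.2 hNr.le)
    refine le_trans ?_ this
    rw [mul_sub, ← mul_assoc, inv_mul_cancel₀ hNr.ne', one_mul]
    have h6 : (N:ℝ)⁻¹ * (C * ∑ j ∈ Finset.Ico N (2*N), p j) ≤ (N:ℝ)⁻¹ * (C * P) := by gcongr
    linarith
  linarith

lemma Sys.limsup (S : Sys T μ p) {B : Set ℝ} (hB : MeasurableSet B) (hBpos : 0 < μ.real B)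
    {H : ℕ → Set ℝ} (hH : ∀ κ, MeasurableSet (H κ)) {Ma Mb : ℕ} (hMa : 1 ≤ Ma)
    (hcov : ∀ᵐ y ∂μ, y ∈ B → ∀ᶠ q in atTop, ∃ i ∈ Finset.Icc Ma Mb, y ∈ H (i * q))
    {N : ℕ → ℕ} (hN : Tendsto N atTop atTop) :
    ∀ᵐ x ∂μ, ∃ᶠ κ in atTop, 1 / (2 * ((Mb:ℝ) + 1)) * μ.real B ≤ Av T (N κ) (H κ) x := by
  have := S.prob
  set c := 1 / (2 * ((Mb:ℝ) + 1)) with hc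
  have hc0 : 0 < c := by positivity
  set Bad : ℕ → Set ℝ := fun k => {x | ∀ κ ≥ k, Av T (N κ) (H κ) x < c * μ.real B} with hBad
  have hBadm : ∀ k, MeasurableSet (Bad k) := by
    intro k
    have : Bad k = ⋂ κ, ⋂ (_ : κ ≥ k), {x | Av T (N κ) (H κ) x < c * μ.real B} := by
      ext x; simp [hBad]
    rw [this]
    exact MeasurableSet.iInter fun κ => MeasurableSet.iInter fun _ => 
      measurableSet_lt (S.Av_meas _ (hH κ)) measurable_const
  suffices hz : ∀ k, μ (Bad k) = 0 by
    have : ∀ᵐ x ∂μ, ∀ k, x ∉ Bad k := ae_all_iff.2 fun k => measure_eq_zero_iff_ae_notMem.1 (hz k)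
    filter_upwards [this] with x hx
    rw [frequently_atTop]
    intro k
    have := hx k
    simp only [hBad, mem_ofPred_eq] at this
    push Not at this
    exact this
  intro k
  by_contra hne
  have hb : 0 < μ.real (Bad k) := by
    rw [measureReal_def]; exact ENNReal.toReal_pos hne (measure_ne_top _ _)
  set b := μ.real (Bad k) with hbdef
  -- covering sets
  set U : ℕ → Set ℝ := fun q => ⋃ i ∈ Finset.Icc Ma Mb, H (i * q) with hU
  have hUm : ∀ q, MeasurableSet (U q) := fun q => Finset.measurableSet_biUnion _ fun i _ => hH _
  set E : ℕ → Set ℝ := fun Q => B ∩ ⋂ q, ⋂ (_ : q ≥ Q), U q with hE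
  have hEmono : Monotone E := by
    intro Q Q' h x hx
    refine ⟨hx.1, ?_⟩
    have := hx.2
    simp only [mem_iInter] at this ⊢
    exact fun q hq => this q (le_trans h hq)
  have hEU : μ B ≤ μ (⋃ Q, E Q) := by
    apply measure_mono_ae
    filter_upwards [hcov] with y hy hyB
    obtain ⟨Q, hQ⟩ := eventually_atTop.1 (hy hyB)
    refine mem_iUnion.2 ⟨Q, hyB, ?_⟩
    simp only [mem_iInter]
    intro q hq
    obtain ⟨i, hi, hi2⟩ := hQ q hq
    exact mem_biUnion hi hi2
  have hlim := tendsto_measure_iUnion_atTop (μ := μ) hEmono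
  have hlt : ENNReal.ofReal (3/4 * μ.real B) < μ (⋃ Q, E Q) := by
    refine lt_of_lt_of_le ?_ hEU
    rw [← ofReal_measureReal (μ := μ) (s := B), ENNReal.ofReal_lt_ofReal_iff hBpos]
    linarith
  have hδ : 0 < μ.real B * b / (8 * ((Mb:ℝ) + 1)) := by positivity
  set δ := μ.real B * b / (8 * ((Mb:ℝ) + 1)) with hδd
  obtain ⟨N0, hN0⟩ := S.mixing (hBadm k) hδ
  have hNev : ∃ K, ∀ κ ≥ K, N0 ≤ N κ := eventually_atTop.1 (hN.eventually_ge_atTop N0)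
  obtain ⟨K, hK⟩ := hNev
  obtain ⟨q, hq1, hq2⟩ := ((hlim.eventually (lt_mem_nhds hlt)).and (eventually_ge_atTop (max k K))).exists
  have hq3 : 3/4 * μ.real B ≤ ∑ i ∈ Finset.Icc Ma Mb, μ.real (H (i * q)) := by
    have h1 : 3/4 * μ.real B ≤ μ.real (U q) := by
      have : ENNReal.ofReal (3/4 * μ.real B) ≤ μ (U q) := by
        refine hq1.le.trans (measure_mono ?_)
        intro x hx
        have := hx.2
        simp only [mem_iInter] at this
        exact this q le_rfl
      exact (ENNReal.ofReal_le_iff_le_toReal (measure_ne_top _ _)).1 this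
    exact h1.trans (measureReal_biUnion_finset_le _ _)
  have hterm : ∀ i ∈ Finset.Icc Ma Mb, b * μ.real (H (i * q)) ≤ δ + c * μ.real B * b := by
    intro i hi
    have hi1 : 1 ≤ i := hMa.trans (Finset.mem_Icc.1 hi).1
    have hiq : max k K ≤ i * q := hq2.trans (Nat.le_mul_of_pos_left q hi1)
    have h1 := hN0 (N (i*q)) (hK _ ((le_max_right _ _).trans hiq)) (H (i*q)) (hH _)
    have h2 : ∫ x, ind1 (Bad k) x * Av T (N (i*q)) (H (i*q)) x ∂μ ≤ ∫ x, (c * μ.real B) * ind1 (Bad k) x ∂μ := by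
      apply integral_mono
      · refine (S.ind_int (hBadm k)).mul_bdd (c := 1) (S.Av_meas _ (hH _)).aestronglyMeasurable (Eventually.of_forall fun x => ?_)
        rw [Real.norm_of_nonneg (Av_nonneg _ _ _ _)]; exact Av_le_one _ _ _ _
      · exact (S.ind_int (hBadm k)).const_mul _
      · intro x
        by_cases hx : x ∈ Bad k
        · have := hx (i*q) ((le_max_left _ _).trans hiq)
          simp only [ind1, indicator_of_mem hx]
          linarith
        · simp [ind1, indicator_of_notMem hx]
    rw [integral_const_mul, S.ind_integral (hBadm k)] at h2
    linarith
  have hfin := Finset.sum_le_sum hterm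
  rw [← Finset.mul_sum, Finset.sum_const, nsmul_eq_mul, Nat.card_Icc] at hfin
  have hcardle : ((Mb + 1 - Ma : ℕ) : ℝ) ≤ (Mb:ℝ) + 1 := by
    exact_mod_cast (by omega : Mb + 1 - Ma ≤ Mb + 1)
  have h7 : ((Mb + 1 - Ma : ℕ) : ℝ) * (δ + c * μ.real B * b) ≤ ((Mb:ℝ) + 1) * (δ + c * μ.real B * b) := by gcongr
  have h8 : ((Mb:ℝ) + 1) * (δ + c * μ.real B * b) = 5/8 * (μ.real B * b) := by
    rw [hδd, hc]; field_simp; norm_num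
  have h9 : b * (3/4 * μ.real B) ≤ b * ∑ i ∈ Finset.Icc Ma Mb, μ.real (H (i * q)) := by gcongr
  have h10 : 0 < μ.real B * b := by positivity
  linarith
end

lemma argmax_exists {F : ℕ → ℝ} (hF0 : ∀ l, 0 < F l) (hF : Tendsto F atTop (nhds 0)) (a : ℕ) :
    ∃ m ≥ a, ∀ l ≥ a, F l ≤ F m := by
  obtain ⟨L, hL⟩ := eventually_atTop.1 (hF.eventually (gt_mem_nhds (hF0 a)))
  obtain ⟨m, hm, hmax⟩ := Finset.exists_max_image (Finset.Icc a (max a L)) F ⟨a, by simp⟩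
  refine ⟨m, (Finset.mem_Icc.1 hm).1, fun l hl => ?_⟩
  by_cases h : l ≤ max a L
  · exact hmax l (Finset.mem_Icc.2 ⟨hl, h⟩)
  · have h1 := hL l (by have := le_max_right a L; omega)
    exact h1.le.trans (hmax a (by simp))

lemma det_scale {M : ℕ → ℝ} (hM0 : ∀ l, 0 < M l) {t s' ε C : ℝ} (ht : 0 < t)
    (hts : t < s') (hε : 0 < ε) (hC : 0 < C)
    (hMC : ∀ l : ℕ, M l ≤ C * 2 ^ (-(l:ℝ) * s')) {K0 : ℕ} 
    (hK : ∀ l ≥ K0, ∀ q : ℕ, (2:ℝ) ^ (-(2 * (q:ℝ)) - ε / 2 * l) * M l ≤ M (l + q)) {Ma : ℕ} (hMa1 : 1 ≤ Ma)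
    (hMa : 4 / ε ≤ Ma) {Mb : ℕ} (hMb : 4 * (Ma:ℝ) / (s' - t) + 1 ≤ Mb) :
    ∀ᶠ q : ℕ in atTop, ∃ i ∈ Finset.Icc Ma Mb, ∀ l ≥ i * q, 
      M l ≤ 2 ^ (ε * ((i * q : ℕ):ℝ)) * 2 ^ (-((l:ℝ) - ((i * q : ℕ):ℝ)) * t) * M (i * q) := by
  set F : ℕ → ℝ := fun l => M l * 2 ^ ((l:ℝ) * t) with hFd
  have hF0 : ∀ l, 0 < F l := fun l => mul_pos (hM0 l) (by positivity)
  have hFle : ∀ l : ℕ, F l ≤ C * (2:ℝ) ^ (-(l:ℝ) * (s' - t)) := by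
    intro l
    have : (2:ℝ) ^ (-(l:ℝ) * (s' - t)) = 2 ^ (-(l:ℝ) * s') * 2 ^ ((l:ℝ) * t) := by
      rw [← Real.rpow_add (by norm_num)]; congr 1; ring
    rw [this, ← mul_assoc]
    exact mul_le_mul_of_nonneg_right (hMC l) (by positivity)
  have hFt : Tendsto F atTop (nhds 0) := by
    have h1 : Tendsto (fun l : ℕ => C * ((2:ℝ) ^ (-(s' - t))) ^ l) atTop (nhds (C * 0)) := by
      apply Tendsto.const_mul
      apply tendsto_pow_atTop_nhds_zero_of_lt_one (by positivity)
      exact Real.rpow_lt_one_of_one_lt_of_neg (by norm_num) (by linarith)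
    rw [mul_zero] at h1
    refine squeeze_zero (fun l => (hF0 l).le) (fun l => (hFle l).trans (le_of_eq ?_)) h1
    rw [← Real.rpow_natCast, ← Real.rpow_mul (by norm_num)]
    congr 2; ring
  -- lower bound on M
  have hlow : ∀ᶠ q : ℕ in atTop, C * (2:ℝ) ^ (-(4 * (q:ℝ))) ≤ M q := by
    set d := (2:ℝ) ^ (- ε / 2 * K0) * M K0 with hd
    have hdp : 0 < d := mul_pos (by positivity) (hM0 _)
    have h1 : Tendsto (fun l : ℕ => C * ((2:ℝ) ^ (-(2:ℝ))) ^ l) atTop (nhds (C * 0)) := by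
      apply Tendsto.const_mul
      apply tendsto_pow_atTop_nhds_zero_of_lt_one (by positivity)
      exact Real.rpow_lt_one_of_one_lt_of_neg (by norm_num) (by norm_num)
    rw [mul_zero] at h1
    filter_upwards [h1.eventually (gt_mem_nhds hdp), eventually_ge_atTop K0] with q hq hqK
    have h2 := hK K0 le_rfl (q - K0)
    rw [Nat.add_sub_cancel' hqK, Nat.cast_sub hqK] at h2
    refine le_trans ?_ h2
    have h3 : (2:ℝ) ^ (-(2 * ((q:ℝ) - K0)) - ε / 2 * K0) * M K0 = 2 ^ (-(2 * ((q:ℝ) - K0))) * d := by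
      rw [hd, ← mul_assoc, ← Real.rpow_add (by norm_num)]; congr 2; ring
    rw [h3]
    have h4 : (2:ℝ) ^ (-(4 * (q:ℝ))) = 2 ^ (-(2 * (q:ℝ))) * (2 ^ (-(2:ℝ))) ^ q := by
      rw [← Real.rpow_natCast, ← Real.rpow_mul (by norm_num), ← Real.rpow_add (by norm_num)]; congr 1; ring
    have h5 : (2:ℝ) ^ (-(2 * (q:ℝ))) ≤ 2 ^ (-(2 * ((q:ℝ) - K0))) := by
      apply Real.rpow_le_rpow_of_exponent_le (by norm_num)
      have : (0:ℝ) ≤ K0 := by positivity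
      linarith
    rw [h4]
    calc C * ((2:ℝ) ^ (-(2 * (q:ℝ))) * (2 ^ (-(2:ℝ))) ^ q) = (2:ℝ) ^ (-(2 * (q:ℝ))) * (C * (2 ^ (-(2:ℝ))) ^ q) := by ring
      _ ≤ 2 ^ (-(2 * ((q:ℝ) - K0))) * d := by gcongr
  have hMaT : Tendsto (fun q => Ma * q) atTop atTop := tendsto_atTop_atTop.2 fun b => ⟨b, fun a ha => ha.trans (Nat.le_mul_of_pos_left a hMa1)⟩
  filter_upwards [hMaT.eventually hlow, eventually_ge_atTop (max K0 1)] with q hq hqK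
  have hq1 : 1 ≤ q := (le_max_right _ _).trans hqK
  have hqK0 : K0 ≤ q := (le_max_left _ _).trans hqK
  have hqr : (1:ℝ) ≤ q := by exact_mod_cast hq1
  obtain ⟨m, hm, hmax⟩ := argmax_exists hF0 hFt (Ma * q)
  have hmr : (Ma:ℝ) * q ≤ m := by exact_mod_cast hm
  have hmle : (m:ℝ) * (s' - t) ≤ 4 * (Ma * q) := by
    have h1 : C * (2:ℝ) ^ (-(4 * ((Ma * q : ℕ):ℝ))) ≤ C * (2:ℝ) ^ (-(m:ℝ) * (s' - t)) := by
      calc _ ≤ M (Ma * q) := hq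
        _ ≤ F (Ma * q) := by
          apply le_mul_of_one_le_right (hM0 _).le
          apply Real.one_le_rpow (by norm_num); positivity
        _ ≤ F m := hmax _ le_rfl
        _ ≤ _ := hFle m
    have h2 := (Real.rpow_le_rpow_left_iff (by norm_num : (1:ℝ) < 2)).1 (le_of_mul_le_mul_left h1 hC)
    push_cast at h2
    linarith
  set i := m / q + 1 with hi
  have hdm := Nat.div_add_mod m q
  have hmod := Nat.mod_lt m (by omega : 0 < q)
  have hiq1 : m < i * q := by rw [hi, add_mul, one_mul, mul_comm]; omega
  have hiq2 : i * q ≤ m + q := by rw [hi, add_mul, one_mul, mul_comm (m / q)]; omega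
  have hκ1 : (m:ℝ) < ((i*q : ℕ) : ℝ) := by exact_mod_cast hiq1
  have hκ2 : ((i*q : ℕ) : ℝ) ≤ m + q := by exact_mod_cast hiq2
  set κ := i * q with hκ
  refine ⟨i, Finset.mem_Icc.2 ⟨?_, ?_⟩, ?_⟩
  · have : Ma * q < i * q := lt_of_le_of_lt hm hiq1
    exact (Nat.lt_of_mul_lt_mul_right this).le
  · have h1 : (m:ℝ) / q ≤ 4 * Ma / (s' - t) := by
      rw [div_le_div_iff₀ (by linarith) (by linarith)]; linarith
    have h2 : ((m / q : ℕ):ℝ) ≤ (m:ℝ) / q := Nat.cast_div_le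
    have h3 : ((m / q + 1 : ℕ):ℝ) ≤ Mb := by push_cast; linarith
    exact_mod_cast h3
  · intro l hl
    have hlr : (κ:ℝ) ≤ l := by exact_mod_cast hl
    have h1 := hmax l (by omega)
    have h2 : M l ≤ 2 ^ (-((l:ℝ) - m) * t) * M m := by
      have e : (2:ℝ) ^ (-((l:ℝ) - m) * t) = 2 ^ ((m:ℝ) * t) / 2 ^ ((l:ℝ) * t) := by
        rw [← Real.rpow_sub (by norm_num)]; congr 1; ring
      rw [e, div_mul_eq_mul_div, le_div_iff₀ (by positivity)]
      simp only [hFd] at h1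
      linarith
    have hmK : K0 ≤ m := by
      have := Nat.le_mul_of_pos_left q hMa1; omega
    have h3 := hK m hmK (κ - m)
    rw [Nat.add_sub_cancel' hiq1.le, Nat.cast_sub hiq1.le] at h3
    have hMa' : 4 ≤ ε * Ma := by rw [div_le_iff₀ hε] at hMa; linarith
    have h4 : M m ≤ 2 ^ (ε * (κ:ℝ)) * M κ := by
      have e : (1:ℝ) ≤ 2 ^ (ε * (κ:ℝ)) * (2:ℝ) ^ (-(2 * ((κ:ℝ) - m)) - ε / 2 * m) := by
        rw [← Real.rpow_add (by norm_num)]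
        apply Real.one_le_rpow (by norm_num)
        nlinarith
      calc M m ≤ (2 ^ (ε * (κ:ℝ)) * (2:ℝ) ^ (-(2 * ((κ:ℝ) - m)) - ε / 2 * m)) * M m := 
            le_mul_of_one_le_left (hM0 m).le e
        _ = 2 ^ (ε * (κ:ℝ)) * ((2:ℝ) ^ (-(2 * ((κ:ℝ) - m)) - ε / 2 * m) * M m) := by ring
        _ ≤ _ := by gcongr
    have h5 : (2:ℝ) ^ (-((l:ℝ) - m) * t) ≤ 2 ^ (-((l:ℝ) - κ) * t) := by
      apply Real.rpow_le_rpow_of_exponent_le (by norm_num)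
      nlinarith
    calc M l ≤ 2 ^ (-((l:ℝ) - m) * t) * M m := h2
      _ ≤ 2 ^ (-((l:ℝ) - κ) * t) * (2 ^ (ε * (κ:ℝ)) * M κ) := by
        gcongr
        exact (hM0 m).le
      _ = _ := by ring

noncomputable def Mm (μ : Measure ℝ) (l : ℕ) (y : ℝ) : ℝ := μ.real (Dy l (idx l y))

def Gs (μ : Measure ℝ) (ε t : ℝ) (κ : ℕ) : Set ℝ := {y | ∀ l ≥ κ, 
  Mm μ l y ≤ 2 ^ (ε * (κ:ℝ)) * 2 ^ (-((l:ℝ) - (κ:ℝ)) * t) * Mm μ κ y}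

def good (μ : Measure ℝ) (ε t : ℝ) (κ : ℕ) (i : ℤ) : Prop :=
  0 < μ.real (Dy κ i) ∧ (2:ℝ) ^ (-(ε * (κ:ℝ))) * μ.real (Dy κ i) ≤ μ.real (Gs μ ε t κ ∩ Dy κ i)

lemma Mm_meas (μ : Measure ℝ) (l : ℕ) : Measurable (Mm μ l) :=
  (measurable_of_countable (fun i : ℤ => μ.real (Dy l i))).comp (measurable_idx l)

lemma Mm_of_mem {μ : Measure ℝ} {l : ℕ} {i : ℤ} {y : ℝ} (h : y ∈ Dy l i) : Mm μ l y = μ.real (Dy l i) := by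
  have : idx l y = i := h
  unfold Mm; rw [this]

lemma Gs_meas (μ : Measure ℝ) (ε t : ℝ) (κ : ℕ) : MeasurableSet (Gs μ ε t κ) := by
  have : Gs μ ε t κ = ⋂ l, ⋂ (_ : l ≥ κ), {y | Mm μ l y ≤ 
    2 ^ (ε * (κ:ℝ)) * 2 ^ (-((l:ℝ) - (κ:ℝ)) * t) * Mm μ κ y} := by
    ext y; simp [Gs]
  rw [this]
  exact MeasurableSet.iInter fun l => MeasurableSet.iInter fun _ =>
    measurableSet_le (Mm_meas μ l) ((Mm_meas μ κ).const_mul _)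

section
variable {T : ℝ → ℝ} {μ : Measure ℝ} {p : ℕ → ℝ}

lemma Sys.le_sum (S : Sys T μ p) (k : ℕ) (E : Set ℝ) :
    μ.real E ≤ ∑ i ∈ Finset.Icc (0:ℤ) (2 ^ k), μ.real (E ∩ Dy k i) := by
  have := S.prob
  refine le_trans ?_ (measureReal_biUnion_finset_le _ _)
  refine ENNReal.toReal_mono (measure_ne_top _ _) (measure_mono_ae ?_)
  filter_upwards [S.aeI] with y hy hyE
  exact mem_biUnion (idx_range (l := k) hy) ⟨hyE, rfl⟩

lemma Sys.Mm_pos (S : Sys T μ p) : ∀ᵐ y ∂μ, ∀ l, 0 < Mm μ l y := by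
  have := S.prob
  rw [ae_all_iff]
  intro l
  have h : μ {y | ¬ 0 < Mm μ l y} ≤ ∑' i : ℤ, μ ({y | ¬ 0 < Mm μ l y} ∩ Dy l i) := by
    refine le_trans (measure_mono ?_) (measure_iUnion_le _)
    intro y hy
    exact mem_iUnion.2 ⟨idx l y, hy, rfl⟩
  rw [ae_iff]
  refine le_antisymm (h.trans (le_of_eq ?_)) bot_le
  rw [ENNReal.tsum_eq_zero]
  intro i
  rcases ({y | ¬ 0 < Mm μ l y} ∩ Dy l i).eq_empty_or_nonempty with h1 | ⟨y, hy1, hy2⟩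
  · rw [h1]; simp
  · have hy1 : ¬ 0 < Mm μ l y := hy1
    rw [Mm_of_mem hy2] at hy1
    have : μ.real (Dy l i) = 0 := le_antisymm (not_lt.1 hy1) measureReal_nonneg
    rw [measureReal_eq_zero_iff] at this
    exact measure_mono_null inter_subset_right this

lemma Sys.drop (S : Sys T μ p) (l q : ℕ) {c : ℝ} (hc : 0 ≤ c) :
    μ.real {y | Mm μ (l + q) y < c * Mm μ l y} ≤ c * 2 ^ q := by
  have := S.prob
  refine (S.le_sum (l + q) _).trans ?_
  have h1 : ∀ i ∈ Finset.Icc (0:ℤ) (2 ^ (l+q)), μ.real ({y | Mm μ (l + q) y < c * Mm μ l y} ∩ Dy (l+q) i) ≤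
      c * μ.real (Dy l (i / 2 ^ q)) := by
    intro i _
    rcases ({y | Mm μ (l + q) y < c * Mm μ l y} ∩ Dy (l+q) i).eq_empty_or_nonempty with h1 | ⟨y, hy1, hy2⟩
    · rw [h1]; simp; exact mul_nonneg hc measureReal_nonneg
    · refine (measureReal_mono inter_subset_right).trans ?_
      have hy1 : Mm μ (l + q) y < c * Mm μ l y := hy1
      have hy3 := Dy_subset (Nat.le_add_right l q) i hy2
      rw [Nat.add_sub_cancel_left] at hy3
      rw [Mm_of_mem hy2, Mm_of_mem hy3] at hy1
      exact hy1.le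
  refine (Finset.sum_le_sum h1).trans ?_
  rw [← Finset.mul_sum]
  apply mul_le_mul_of_nonneg_left _ hc
  set I := Finset.Icc (0:ℤ) (2 ^ (l+q))
  rw [← Finset.sum_fiberwise_of_maps_to (s := I) (t := I.image (fun i => i / 2 ^ q)) (g := fun i => i / 2 ^ q)
    (fun i hi => Finset.mem_image_of_mem _ hi)]
  have h2 : ∀ J ∈ I.image (fun i => i / 2 ^ q), ∑ i ∈ I with i / 2 ^ q = J, μ.real (Dy l (i / 2 ^ q)) ≤ 
      2 ^ q * μ.real (Dy l J) := by
    intro J _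
    rw [Finset.sum_congr rfl (g := fun _ => μ.real (Dy l J)) (fun i hi => by rw [(Finset.mem_filter.1 hi).2])]
    rw [Finset.sum_const, nsmul_eq_mul]
    apply mul_le_mul_of_nonneg_right _ measureReal_nonneg
    have hsub : (I.filter fun i => i / 2 ^ q = J) ⊆ Finset.Ico (J * 2 ^ q) ((J + 1) * 2 ^ q) := by
      intro i hi
      have h3 := (Finset.mem_filter.1 hi).2
      have hp : (0:ℤ) < 2 ^ q := by positivity
      rw [Finset.mem_Ico, ← h3]
      exact ⟨Int.ediv_mul_le _ hp.ne', Int.lt_ediv_add_one_mul_self _ hp⟩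
    have h4 := Finset.card_le_card hsub
    rw [Int.card_Ico] at h4
    have h5 : ((J + 1) * 2 ^ q - J * 2 ^ q : ℤ) = ((2 ^ q : ℕ) : ℤ) := by push_cast; ring
    rw [h5, Int.toNat_natCast] at h4
    exact_mod_cast h4
  refine (Finset.sum_le_sum h2).trans ?_
  rw [← Finset.mul_sum]
  exact mul_le_of_le_one_right (by positivity) (S.sum_Dy_le l _)

lemma Sys.ae_drop (S : Sys T μ p) {ε : ℝ} (hε : 0 < ε) : ∀ᵐ y ∂μ, ∃ K0 : ℕ, ∀ l ≥ K0, ∀ q : ℕ, 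
    (2:ℝ) ^ (-(2 * (q:ℝ)) - ε / 2 * l) * Mm μ l y ≤ Mm μ (l + q) y := by
  have := S.prob
  set E : ℕ × ℕ → Set ℝ := fun a => {y | Mm μ (a.1 + a.2) y < (2:ℝ) ^ (-(2 * (a.2:ℝ)) - ε / 2 * a.1) * Mm μ a.1 y} with hE
  have hb : ∀ a, μ (E a) ≤ ENNReal.ofReal (((2:ℝ) ^ (-(ε/2))) ^ a.1 * ((1/2:ℝ)) ^ a.2) := by
    intro a
    rw [← ofReal_measureReal]
    apply ENNReal.ofReal_le_ofReal
    refine (S.drop a.1 a.2 (by positivity)).trans (le_of_eq ?_)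
    rw [one_div, ← Real.rpow_neg_one, ← Real.rpow_natCast, ← Real.rpow_natCast, ← Real.rpow_natCast,
      ← Real.rpow_mul (by norm_num), ← Real.rpow_mul (by norm_num), ← Real.rpow_add (by norm_num), 
      ← Real.rpow_add (by norm_num)]
    congr 1; ring
  have hsum : ∑' a, μ (E a) ≠ ⊤ := by
    have h1 : Summable fun l : ℕ => ((2:ℝ) ^ (-(ε/2))) ^ l := summable_geometric_of_lt_one (by positivity)
      (Real.rpow_lt_one_of_one_lt_of_neg (by norm_num) (by linarith))
    have h2 : Summable fun l : ℕ => (1/2:ℝ) ^ l := summable_geometric_of_lt_one (by positivity) (by norm_num)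
    have h3 := h1.mul_of_nonneg h2 (fun _ => by positivity) (fun _ => by positivity)
    exact ne_top_of_le_ne_top h3.tsum_ofReal_ne_top (ENNReal.tsum_le_tsum hb)
  filter_upwards [ae_finite_setOfPred_mem hsum] with y hy
  obtain ⟨K, hK⟩ := (hy.image Prod.fst).bddAbove
  refine ⟨K + 1, fun l hl q => ?_⟩
  by_contra hlt
  push Not at hlt
  have := hK ⟨(l, q), hlt, rfl⟩
  simp only at this
  omega

lemma Sys.notgood (S : Sys T μ p) {ε t : ℝ} (κ : ℕ) :
    μ.real (Gs μ ε t κ ∩ {y | ¬ good μ ε t κ (idx κ y)}) ≤ (2:ℝ) ^ (-(ε * (κ:ℝ))) := by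
  have := S.prob
  refine (S.le_sum κ _).trans ?_
  have h1 : ∀ i ∈ Finset.Icc (0:ℤ) (2 ^ κ), μ.real (Gs μ ε t κ ∩ {y | ¬ good μ ε t κ (idx κ y)} ∩ Dy κ i) ≤
      (2:ℝ) ^ (-(ε * (κ:ℝ))) * μ.real (Dy κ i) := by
    intro i _
    by_cases hg : good μ ε t κ i
    · have : Gs μ ε t κ ∩ {y | ¬ good μ ε t κ (idx κ y)} ∩ Dy κ i = ∅ := by
        ext y
        simp only [mem_inter_iff, mem_ofPred_eq, mem_empty_iff_false, iff_false]
        rintro ⟨⟨-, h⟩, h2⟩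
        have h2 : idx κ y = i := h2
        rw [h2] at h; exact h hg
      rw [this]; simp; positivity
    · have hle : μ.real (Gs μ ε t κ ∩ {y | ¬ good μ ε t κ (idx κ y)} ∩ Dy κ i) ≤ μ.real (Gs μ ε t κ ∩ Dy κ i) :=
        measureReal_mono fun y hy => ⟨hy.1.1, hy.2⟩
      refine hle.trans ?_
      unfold good at hg
      rw [not_and_or] at hg
      rcases hg with h | h
      · have h0 : μ.real (Dy κ i) = 0 := le_antisymm (not_lt.1 h) measureReal_nonneg
        rw [h0, mul_zero, ← h0]
        exact measureReal_mono inter_subset_right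
      · exact (not_le.1 h).le
  refine (Finset.sum_le_sum h1).trans ?_
  rw [← Finset.mul_sum]
  exact mul_le_of_le_one_right (by positivity) (S.sum_Dy_le κ _)

lemma Sys.good_scales (S : Sys T μ p) {ε t s' C : ℝ} (hε : 0 < ε) (ht : 0 < t) (hts : t < s') (hC : 0 < C)
    (hMC : ∀ (l : ℕ) i, μ.real (Dy l i) ≤ C * 2 ^ (-(l:ℝ) * s')) : 
    ∃ Ma Mb : ℕ, 1 ≤ Ma ∧ ∀ᵐ y ∂μ, ∀ᶠ q in atTop, ∃ i ∈ Finset.Icc Ma Mb, good μ ε t (i * q) (idx (i * q) y) := by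
  have := S.prob
  obtain ⟨Ma, hMa⟩ := exists_nat_ge (4 / ε)
  obtain ⟨Mb, hMb⟩ := exists_nat_ge (4 * ((Ma + 1 : ℕ):ℝ) / (s' - t) + 1)
  refine ⟨Ma + 1, Mb, by omega, ?_⟩
  have hbc : ∀ᵐ y ∂μ, ∀ᶠ κ in atTop, y ∉ Gs μ ε t κ ∩ {y | ¬ good μ ε t κ (idx κ y)} := by
    apply ae_eventually_notMem
    have h1 : Summable fun κ : ℕ => ((2:ℝ) ^ (-ε)) ^ κ := summable_geometric_of_lt_one (by positivity)
      (Real.rpow_lt_one_of_one_lt_of_neg (by norm_num) (by linarith))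
    refine ne_top_of_le_ne_top h1.tsum_ofReal_ne_top (ENNReal.tsum_le_tsum fun κ => ?_)
    rw [← ofReal_measureReal]
    apply ENNReal.ofReal_le_ofReal
    refine (S.notgood κ).trans (le_of_eq ?_)
    rw [← Real.rpow_natCast, ← Real.rpow_mul (by norm_num)]; congr 1; ring
  filter_upwards [hbc, S.ae_drop hε, S.Mm_pos] with y h1 ⟨K0, h2⟩ h3
  obtain ⟨K, hK⟩ := eventually_atTop.1 h1
  have h4 := det_scale (M := fun l => Mm μ l y) h3 ht hts hε hC (fun l => hMC l _) h2 (Ma := Ma + 1) (by omega)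
    (by push_cast; linarith) hMb
  filter_upwards [h4, eventually_ge_atTop K] with q ⟨i, hi, hq⟩ hqK
  refine ⟨i, hi, ?_⟩
  have hi1 : 1 ≤ i := by have := (Finset.mem_Icc.1 hi).1; omega
  have h5 := hK (i * q) (le_trans hqK (Nat.le_mul_of_pos_left q hi1))
  by_contra hng
  exact h5 ⟨hq, hng⟩
end

def Vis (T : ℝ → ℝ) (N : ℕ → ℕ) (x : ℝ) (κ : ℕ) (i : ℤ) : Prop :=
  ∃ j ∈ Finset.Ico (N κ) (2 * N κ), T^[j] x ∈ Dy κ i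

def Hs (μ : Measure ℝ) (ε t : ℝ) (B : Set ℝ) (κ : ℕ) : Set ℝ :=
  {y | good μ ε t κ (idx κ y) ∧ (Dy κ (idx κ y) ∩ B).Nonempty}

lemma Hs_meas (μ : Measure ℝ) (ε t : ℝ) (B : Set ℝ) (κ : ℕ) : MeasurableSet (Hs μ ε t B κ) :=
  measurable_idx κ (MeasurableSet.of_discrete (s := {i : ℤ | good μ ε t κ i ∧ (Dy κ i ∩ B).Nonempty}))

lemma ind1_Dy (k : ℕ) (c : ℤ) (y : ℝ) : ind1 (Dy k c) y = if idx k y = c then 1 else 0 := by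
  by_cases h : idx k y = c
  · rw [if_pos h]; exact indicator_of_mem (show y ∈ Dy k c from h) _
  · rw [if_neg h]; exact indicator_of_notMem (show y ∉ Dy k c from h) _

lemma sum_ind1 (k : ℕ) (F : Finset ℤ) (y : ℝ) : ∑ c ∈ F, ind1 (Dy k c) y = if idx k y ∈ F then 1 else 0 := by
  simp_rw [ind1_Dy]
  rw [Finset.sum_ite_eq]

lemma sum_Av_le (T : ℝ → ℝ) (N : ℕ) (x : ℝ) {k l : ℕ} (h : l ≤ k) (e : ℤ) (F : Finset ℤ)
    (hF : ∀ c ∈ F, c / 2 ^ (k - l) = e) : ∑ c ∈ F, Av T N (Dy k c) x ≤ Av T N (Dy l e) x := by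
  unfold Av
  rw [← Finset.mul_sum, Finset.sum_comm]
  gcongr with j hj
  rw [sum_ind1]
  split_ifs with h1
  · have : idx l (T^[j] x) = e := by rw [idx_anc h, hF _ h1]
    rw [ind1_Dy, if_pos this]
  · exact ind1_nonneg _ _

set_option maxHeartbeats 4000000 in
lemma Sys.one_step {T : ℝ → ℝ} {μ : Measure ℝ} {p : ℕ → ℝ} (S : Sys T μ p) {x ε t C c : ℝ} {N : ℕ → ℕ} 
    (hε : 0 < ε) (ht : 0 < t) (hC : 0 < C) (hc : 0 < c)
    (hMC : ∀ (l : ℕ) i, μ.real (Dy l i) ≤ C * 2 ^ (-(l:ℝ) * (t + 5 * ε)))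
    (hx : ∀ j, T^[j] x ∈ Icc (0:ℝ) 1)
    (hX : Tendsto (fun κ => Xv T μ (t + 4 * ε) (N κ) κ x) atTop (nhds 0))
    {κmin : ℕ} (hκmin : ∀ κ ≥ κmin, 4 / c ≤ (2:ℝ) ^ (ε * (κ:ℝ))) {κ0 : ℕ} {i0 : ℤ} (h0 : κmin ≤ κ0) 
    (hg : good μ ε t κ0 i0) 
    (hfreq : ∃ᶠ κ in atTop, c * μ.real (Gs μ ε t κ0 ∩ Dy κ0 i0) ≤ 
      Av T (N κ) (Hs μ ε t (Gs μ ε t κ0 ∩ Dy κ0 i0) κ) x) :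
    StepProp t (t + 3 * ε) (fun κ i => good μ ε t κ i ∧ κmin ≤ κ) (Vis T N x) κ0 i0 := by
  classical
  have := S.prob
  set B := Gs μ ε t κ0 ∩ Dy κ0 i0 with hB
  have hJ := hg.1
  have hBJ := hg.2
  rw [← hB] at hBJ
  have hBpos : 0 < μ.real B := lt_of_lt_of_le (by positivity) hBJ
  set z := c * μ.real B with hz
  have hz0 : 0 < z := by positivity
  set ρ : ℝ := (2:ℝ) ^ (-ε) with hρ
  have hρ0 : 0 < ρ := by positivity
  have hρ1 : ρ < 1 := Real.rpow_lt_one_of_one_lt_of_neg (by norm_num) (by linarith)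
  have hρpow : ∀ l : ℕ, ρ ^ l = (2:ℝ) ^ (-(ε * (l:ℝ))) := by
    intro l
    rw [hρ, ← Real.rpow_natCast, ← Real.rpow_mul (by norm_num)]; congr 1; ring
  -- choose L
  obtain ⟨L, hL1, hL2⟩ : ∃ L : ℕ, 2 * C * (ρ ^ (L+1) / (1 - ρ)) ≤ z / 4 ∧ ρ ^ L ≤ z / 2 := by
    have hp := tendsto_pow_atTop_nhds_zero_of_lt_one hρ0.le hρ1
    have hp1 : Tendsto (fun L : ℕ => 2 * C * (ρ ^ (L+1) / (1 - ρ))) atTop (nhds (2 * C * (0 / (1 - ρ)))) :=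
      (((tendsto_add_atTop_iff_nat 1).2 hp).div_const _).const_mul _
    simp only [zero_div, mul_zero] at hp1
    obtain ⟨L, h1, h2⟩ := ((hp1.eventually (ge_mem_nhds (show 0 < z/4 by positivity))).and 
      (hp.eventually (ge_mem_nhds (show 0 < z/2 by positivity)))).exists
    exact ⟨L, h1, h2⟩
  set δ := z / 4 * (2:ℝ) ^ (-(L:ℝ) * t) with hδ
  have hδ0 : 0 < δ := by positivity
  set η := min (z / 8) (δ ^ 2) with hη
  have hη0 : 0 < η := lt_min (by positivity) (by positivity)
  obtain ⟨κ', hκA, hκX, hκgt⟩ := (hfreq.and_eventually ((hX.eventually (ge_mem_nhds hη0)).and 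
    (eventually_gt_atTop (max L κ0)))).exists
  have hκL : L < κ' := (le_max_left _ _).trans_lt hκgt
  have hκκ : κ0 < κ' := (le_max_right _ _).trans_lt hκgt
  have hX1 : Xv T μ (t + 4 * ε) (N κ') κ' x ≤ z / 8 := hκX.trans (min_le_left _ _)
  have hX2 : Xv T μ (t + 4 * ε) (N κ') κ' x ≤ δ ^ 2 := hκX.trans (min_le_right _ _)
  set A : ℕ → ℤ → ℝ := fun l e => Av T (N κ') (Dy l e) x with hA
  have hA0 : ∀ l e, 0 ≤ A l e := fun l e => Av_nonneg _ _ _ _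
  set heavy : ℕ → Finset ℤ := fun l => (Finset.Icc (0:ℤ) (2 ^ l)).filter 
    (fun e => (2:ℝ) ^ (-(l:ℝ) * (t + 4 * ε)) < A l e) with hheavy
  set Ch : Finset ℤ := (Finset.Icc (0:ℤ) (2 ^ κ')).filter (fun i => good μ ε t κ' i ∧ (Dy κ' i ∩ B).Nonempty ∧
    Vis T N x κ' i ∧ ∀ l, L < l → l ≤ κ' → A l (i / 2 ^ (κ' - l)) ≤ (2:ℝ) ^ (-(l:ℝ) * (t + 4 * ε))) with hCh
  -- mass estimate
  have hmass : z ≤ ∑ i ∈ Ch, A κ' i + ∑ l ∈ Finset.Ico (L+1) (κ'+1), ∑ e ∈ heavy l, A l e := by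
    refine hκA.trans ?_
    simp only [hA]
    unfold Av
    simp_rw [← Finset.mul_sum]
    rw [← mul_add]
    gcongr
    rw [Finset.sum_comm]
    have : ∑ l ∈ Finset.Ico (L+1) (κ'+1), ∑ e ∈ heavy l, ∑ j ∈ Finset.Ico (N κ') (2 * N κ'), ind1 (Dy l e) (T^[j] x) =
        ∑ j ∈ Finset.Ico (N κ') (2 * N κ'), ∑ l ∈ Finset.Ico (L+1) (κ'+1), ∑ e ∈ heavy l, ind1 (Dy l e) (T^[j] x) := by
      rw [Finset.sum_comm]
      apply Finset.sum_congr rfl; intro l _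
      rw [Finset.sum_comm]
    rw [this, ← Finset.sum_add_distrib]
    apply Finset.sum_le_sum
    intro j hj
    set y := T^[j] x with hy
    have hy01 := hx j
    rw [← hy] at hy01
    simp_rw [sum_ind1]
    have hnn : ∀ l ∈ Finset.Ico (L+1) (κ'+1), (0:ℝ) ≤ if idx l y ∈ heavy l then 1 else 0 := by
      intro l _; split_ifs <;> norm_num
    by_cases hyH : y ∈ Hs μ ε t B κ'
    · by_cases hyC : idx κ' y ∈ Ch
      · rw [if_pos hyC]
        have := Finset.sum_nonneg hnn
        linarith [ind1_le (Hs μ ε t B κ') y]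
      · have hl : ∃ l, L < l ∧ l ≤ κ' ∧ (2:ℝ) ^ (-(l:ℝ) * (t + 4 * ε)) < A l (idx l y) := by
          by_contra hno
          push Not at hno
          apply hyC
          rw [hCh, Finset.mem_filter]
          refine ⟨idx_range hy01, hyH.1, hyH.2, ⟨j, hj, rfl⟩, fun l h1 h2 => ?_⟩
          rw [← idx_anc h2]
          exact hno l h1 h2
        obtain ⟨l, h1, h2, h3⟩ := hl
        have hmem : idx l y ∈ heavy l := Finset.mem_filter.2 ⟨idx_range hy01, h3⟩
        have h4 := Finset.single_le_sum hnn (Finset.mem_Ico.2 ⟨h1, Nat.lt_succ_of_le h2⟩)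
        rw [if_pos hmem] at h4
        have h5 : (0:ℝ) ≤ if idx κ' y ∈ Ch then 1 else 0 := by split_ifs <;> norm_num
        linarith [ind1_le (Hs μ ε t B κ') y]
    · have : ind1 (Hs μ ε t B κ') y = 0 := indicator_of_notMem hyH _
      rw [this]
      have h5 : (0:ℝ) ≤ if idx κ' y ∈ Ch then 1 else 0 := by split_ifs <;> norm_num
      have := Finset.sum_nonneg hnn
      linarith
  have hheavysum : ∑ l ∈ Finset.Ico (L+1) (κ'+1), ∑ e ∈ heavy l, A l e ≤ z / 2 := by
    have h1 : ∀ l ∈ Finset.Ico (L+1) (κ'+1), ∑ e ∈ heavy l, A l e ≤ 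
        2 * ((2:ℝ) ^ ((l:ℝ) * (t + 4 * ε)) * ∑ e ∈ Finset.Icc (0:ℤ) (2 ^ l), (A l e - μ.real (Dy l e)) ^ 2) +
        2 * C * ρ ^ l := by
      intro l _
      set Q := (2:ℝ) ^ ((l:ℝ) * (t + 4 * ε)) with hQ
      have hQ0 : 0 < Q := by positivity
      have hterm : ∀ e ∈ heavy l, A l e ≤ 2 * (Q * (A l e - μ.real (Dy l e)) ^ 2) + 2 * Q * μ.real (Dy l e) ^ 2 := by
        intro e he
        have h2 := (Finset.mem_filter.1 he).2
        have h3 : 1 ≤ Q * A l e := by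
          have : (2:ℝ) ^ (-(l:ℝ) * (t + 4 * ε)) = Q⁻¹ := by
            rw [hQ, ← Real.rpow_neg (by norm_num)]; congr 1; ring
          rw [this] at h2
          have := mul_le_mul_of_nonneg_left h2.le hQ0.le
          rwa [mul_inv_cancel₀ hQ0.ne'] at this
        have h4 : A l e ≤ Q * A l e ^ 2 := by nlinarith [hA0 l e]
        nlinarith [mul_nonneg hQ0.le (sq_nonneg (A l e - 2 * μ.real (Dy l e)))]
      refine (Finset.sum_le_sum hterm).trans ?_
      refine (Finset.sum_le_sum_of_subset_of_nonneg (Finset.filter_subset _ _) 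
        (fun e _ _ => by positivity)).trans ?_
      rw [Finset.sum_add_distrib, ← Finset.mul_sum, ← Finset.mul_sum, ← Finset.mul_sum]
      have h5 : ∑ e ∈ Finset.Icc (0:ℤ) (2 ^ l), μ.real (Dy l e) ^ 2 ≤ C * 2 ^ (-(l:ℝ) * (t + 5 * ε)) := by
        calc _ ≤ ∑ e ∈ Finset.Icc (0:ℤ) (2 ^ l), C * 2 ^ (-(l:ℝ) * (t + 5 * ε)) * μ.real (Dy l e) := by
              apply Finset.sum_le_sum; intro e _
              rw [sq]; exact mul_le_mul_of_nonneg_right (hMC l e) measureReal_nonneg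
          _ ≤ _ := by
              rw [← Finset.mul_sum]
              exact mul_le_of_le_one_right (by positivity) (S.sum_Dy_le l _)
      have h6 : 2 * Q * (C * 2 ^ (-(l:ℝ) * (t + 5 * ε))) = 2 * C * ρ ^ l := by
        have : Q * 2 ^ (-(l:ℝ) * (t + 5 * ε)) = ρ ^ l := by
          rw [hρpow, hQ, ← Real.rpow_add (by norm_num)]; congr 1; ring
        rw [← this]; ring
      have h7 := mul_le_mul_of_nonneg_left h5 (show 0 ≤ 2 * Q by positivity)
      linarith
    refine (Finset.sum_le_sum h1).trans ?_
    rw [Finset.sum_add_distrib, ← Finset.mul_sum, ← Finset.mul_sum]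
    have h2 : ∑ l ∈ Finset.Ico (L+1) (κ'+1), ((2:ℝ) ^ ((l:ℝ) * (t + 4 * ε)) * 
        ∑ e ∈ Finset.Icc (0:ℤ) (2 ^ l), (A l e - μ.real (Dy l e)) ^ 2) ≤ Xv T μ (t + 4 * ε) (N κ') κ' x := by
      unfold Xv
      rw [Finset.range_eq_Ico]
      exact Finset.sum_le_sum_of_subset_of_nonneg (Finset.Ico_subset_Ico (Nat.zero_le _) le_rfl) 
        (fun l _ _ => mul_nonneg (by positivity) (Finset.sum_nonneg fun _ _ => sq_nonneg _))
    have h3 : ∑ l ∈ Finset.Ico (L+1) (κ'+1), ρ ^ l ≤ ρ ^ (L+1) / (1 - ρ) := geom_sum_Ico_le_of_lt_one hρ0.le hρ1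
    have h4 := mul_le_mul_of_nonneg_left h3 (show 0 ≤ 2 * C by positivity)
    linarith
  -- fine scale bound
  have hfine : ∀ l : ℕ, L < l → 2 / z * (2:ℝ) ^ (-(l:ℝ) * (t + 4 * ε)) ≤ (2:ℝ) ^ (-(l:ℝ) * (t + 3 * ε)) := by
    intro l hl
    have h1 : (2:ℝ) ^ (-(l:ℝ) * (t + 4 * ε)) = ρ ^ l * (2:ℝ) ^ (-(l:ℝ) * (t + 3 * ε)) := by
      rw [hρpow, ← Real.rpow_add (by norm_num)]; congr 1; ring
    have h2 : ρ ^ l ≤ z / 2 := (pow_le_pow_of_le_one hρ0.le hρ1.le hl.le).trans hL2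
    have h3 : 2 / z * ρ ^ l ≤ 1 := by
      rw [div_mul_eq_mul_div, div_le_one hz0]; linarith
    rw [h1, ← mul_assoc]
    exact mul_le_of_le_one_left (by positivity) h3
  have hbig : (1:ℝ) ≤ (2:ℝ) ^ ((κ0:ℝ) * (t + 3 * ε)) := Real.one_le_rpow (by norm_num) (by positivity)
  have hz2 : 0 < 2 / z := by positivity
  refine ⟨κ', hκκ, Ch, fun i => 2 / z * A κ' i, ?_, ?_, ?_⟩
  · intro i hi
    obtain ⟨hi1, hi2, ⟨y, hy1, hy2⟩, hi3, hi4⟩ := Finset.mem_filter.1 hi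
    refine ⟨⟨hi2, h0.trans hκκ.le⟩, hi3, ?_, mul_nonneg hz2.le (hA0 _ _), ?_⟩
    · have h1 : idx κ0 y = _ := Dy_subset hκκ.le i hy1
      have h2 : idx κ0 y = i0 := hy2.2
      rw [← h1, h2]
    · have h1 := hi4 κ' hκL le_rfl
      rw [Nat.sub_self, pow_zero, Int.ediv_one] at h1
      calc 2 / z * A κ' i ≤ 2 / z * (2:ℝ) ^ (-(κ':ℝ) * (t + 4 * ε)) := by gcongr
        _ ≤ (2:ℝ) ^ (-(κ':ℝ) * (t + 3 * ε)) := hfine κ' hκL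
        _ ≤ _ := le_mul_of_one_le_left (by positivity) hbig
  · rw [← Finset.mul_sum]
    have : z / 2 ≤ ∑ i ∈ Ch, A κ' i := by linarith
    calc (1:ℝ) = 2 / z * (z / 2) := by field_simp
      _ ≤ _ := by gcongr
  · intro l hl1 hl2 e
    rcases (Ch.filter fun i => i / 2 ^ (κ' - l) = e).eq_empty_or_nonempty with hemp | ⟨i, hi⟩
    · rw [hemp, Finset.sum_empty]; positivity
    obtain ⟨hiC, hie⟩ := Finset.mem_filter.1 hi
    obtain ⟨hi1, hi2, ⟨y, hy1, hy2⟩, ⟨j, hj, hjD⟩, hi4⟩ := Finset.mem_filter.1 hiC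
    have hsumle : ∑ i ∈ Ch with i / 2 ^ (κ' - l) = e, 2 / z * A κ' i ≤ 2 / z * A l e := by
      rw [← Finset.mul_sum]
      gcongr
      exact sum_Av_le T (N κ') x hl2.le e _ (fun i hi => (Finset.mem_filter.1 hi).2)
    refine hsumle.trans ?_
    by_cases hlL : L < l
    · have h1 := hi4 l hlL hl2.le
      rw [hie] at h1
      calc 2 / z * A l e ≤ 2 / z * (2:ℝ) ^ (-(l:ℝ) * (t + 4 * ε)) := by gcongr
        _ ≤ (2:ℝ) ^ (-(l:ℝ) * (t + 3 * ε)) := hfine l hlL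
        _ ≤ (2:ℝ) ^ (-(l:ℝ) * t) := by
          apply Real.rpow_le_rpow_of_exponent_le (by norm_num)
          nlinarith [(Nat.cast_nonneg l : (0:ℝ) ≤ l)]
        _ ≤ _ := le_mul_of_one_le_left (by positivity) hbig
    · push Not at hlL
      have hyl : y ∈ Dy l e := by
        have := Dy_subset hl2.le i hy1
        rwa [hie] at this
      have heI : e ∈ Finset.Icc (0:ℤ) (2 ^ l) := by
        have : idx l (T^[j] x) = _ := Dy_subset hl2.le i hjD
        rw [hie] at this
        rw [← this]; exact idx_range (hx j)
      have hsq : (A l e - μ.real (Dy l e)) ^ 2 ≤ δ ^ 2 := by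
        refine le_trans ?_ hX2
        unfold Xv
        refine le_trans ?_ (Finset.single_le_sum (f := fun l : ℕ => (2:ℝ) ^ ((l:ℝ) * (t + 4 * ε)) * 
          ∑ i ∈ Finset.Icc (0:ℤ) (2 ^ l), (Av T (N κ') (Dy l i) x - μ.real (Dy l i)) ^ 2) 
          (fun l _ => mul_nonneg (by positivity) (Finset.sum_nonneg fun _ _ => sq_nonneg _)) 
          (Finset.mem_range.2 (by omega : l < κ' + 1)))
        refine le_trans ?_ (le_mul_of_one_le_left (Finset.sum_nonneg fun _ _ => sq_nonneg _) 
          (Real.one_le_rpow (by norm_num) (by positivity)))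
        exact Finset.single_le_sum (f := fun i => (Av T (N κ') (Dy l i) x - μ.real (Dy l i)) ^ 2) 
          (fun _ _ => sq_nonneg _) heI
      have hAμ : A l e ≤ μ.real (Dy l e) + δ := by
        have := (abs_le.1 (abs_le_of_sq_le_sq hsq hδ0.le)).2
        linarith
      have hyG := hy2.1 l hl1.le
      rw [Mm_of_mem hyl, Mm_of_mem hy2.2] at hyG
      set R := (2:ℝ) ^ (ε * (κ0:ℝ)) with hR
      have hR0 : 0 < R := by positivity
      have hJB : μ.real (Dy κ0 i0) ≤ R * μ.real B := by
        rw [Real.rpow_neg (by norm_num), ← hR, inv_mul_le_iff₀ hR0] at hBJ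
        exact hBJ
      have hcR : 4 / c ≤ R := hκmin κ0 h0
      set W := (2:ℝ) ^ (-((l:ℝ) - (κ0:ℝ)) * t) with hW
      have hW0 : 0 < W := by positivity
      have htarget : (2:ℝ) ^ ((κ0:ℝ) * (t + 3 * ε)) * 2 ^ (-(l:ℝ) * t) = R * R * R * W := by
        rw [hR, hW, ← Real.rpow_add (by norm_num), ← Real.rpow_add (by norm_num), ← Real.rpow_add (by norm_num),
          ← Real.rpow_add (by norm_num)]
        congr 1; ring
      have hp1 : 2 / z * μ.real (Dy l e) ≤ 1 / 2 * (R * R * R * W) := by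
        have h1 : μ.real (Dy l e) ≤ R * W * (R * μ.real B) := hyG.trans (by gcongr)
        calc 2 / z * μ.real (Dy l e) ≤ 2 / z * (R * W * (R * μ.real B)) := by gcongr
          _ = 1 / 2 * (4 / c * R * R * W) := by rw [hz]; field_simp; norm_num
          _ ≤ _ := by gcongr
      have hp2 : 2 / z * δ ≤ 1 / 2 * ((2:ℝ) ^ ((κ0:ℝ) * (t + 3 * ε)) * 2 ^ (-(l:ℝ) * t)) := by
        have h1 : (2:ℝ) ^ (-(L:ℝ) * t) ≤ 2 ^ (-(l:ℝ) * t) := by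
          apply Real.rpow_le_rpow_of_exponent_le (by norm_num)
          have : (l:ℝ) ≤ L := by exact_mod_cast hlL
          nlinarith
        calc 2 / z * δ = 1 / 2 * (2:ℝ) ^ (-(L:ℝ) * t) := by rw [hδ]; field_simp; norm_num
          _ ≤ 1 / 2 * (2:ℝ) ^ (-(l:ℝ) * t) := by gcongr
          _ ≤ _ := by
            gcongr
            exact le_mul_of_one_le_left (by positivity) hbig
      calc 2 / z * A l e ≤ 2 / z * (μ.real (Dy l e) + δ) := by gcongr
        _ = 2 / z * μ.real (Dy l e) + 2 / z * δ := by ring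
        _ ≤ _ := by rw [← htarget] at hp1; linarith

noncomputable def Nf (α : ℝ) (κ : ℕ) : ℕ := max 1 ⌊(2:ℝ) ^ ((κ:ℝ) / α) / 2⌋₊

lemma Nf_lower {α : ℝ} (κ : ℕ) : (2:ℝ) ^ ((κ:ℝ) / α) ≤ 4 * Nf α κ := by
  set u := (2:ℝ) ^ ((κ:ℝ) / α) with hu
  have h1 : (1:ℝ) ≤ Nf α κ := by exact_mod_cast le_max_left _ _
  have h2 : ((⌊u / 2⌋₊ : ℕ) : ℝ) ≤ Nf α κ := by exact_mod_cast le_max_right _ _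
  have h3 := Nat.lt_floor_add_one (u / 2)
  linarith

lemma Nf_tendsto {α : ℝ} (hα : 0 < α) : Tendsto (Nf α) atTop atTop := by
  have h1 : Tendsto (fun κ : ℕ => (2:ℝ) ^ ((κ:ℝ) / α)) atTop atTop := by
    apply (tendsto_rpow_atTop_of_base_gt_one 2 (by norm_num)).comp
    exact tendsto_natCast_atTop_atTop.atTop_div_const hα
  have h2 : Tendsto (fun κ : ℕ => (Nf α κ : ℝ)) atTop atTop := by
    refine tendsto_atTop_mono (f := fun κ : ℕ => (2:ℝ) ^ ((κ:ℝ) / α) / 4) (fun κ => ?_) 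
      (h1.atTop_div_const (by norm_num))
    have := Nf_lower (α := α) κ
    linarith
  exact tendsto_natCast_atTop_iff.1 h2

lemma Nf_vis {α : ℝ} (hα : 0 < α) {κ j : ℕ} (hκ : 2 ≤ (2:ℝ) ^ ((κ:ℝ) / α)) (h1 : Nf α κ ≤ j) 
    (h2 : j < 2 * Nf α κ) : 1 / (2:ℝ) ^ κ < (j:ℝ) ^ (-α) := by
  set u := (2:ℝ) ^ ((κ:ℝ) / α) with hu
  have hN : Nf α κ = ⌊u / 2⌋₊ := max_eq_right (Nat.le_floor (by push_cast; linarith))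
  have h3 : ((⌊u / 2⌋₊ : ℕ) : ℝ) ≤ u / 2 := Nat.floor_le (by linarith)
  have hj0 : (1:ℝ) ≤ j := by exact_mod_cast (le_max_left _ _).trans h1
  have hju : (j:ℝ) < u := by
    have : (j:ℝ) < 2 * (Nf α κ : ℝ) := by exact_mod_cast h2
    rw [hN] at this
    linarith
  have h4 : (j:ℝ) ^ α < 2 ^ κ := by
    have h5 : u ^ α = 2 ^ κ := by
      rw [hu, ← Real.rpow_mul (by norm_num), div_mul_cancel₀ _ hα.ne', Real.rpow_natCast]
    rw [← h5]
    exact Real.rpow_lt_rpow (by linarith) hju hα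
  rw [Real.rpow_neg (by linarith), one_div]
  exact inv_strictAnti₀ (by positivity) h4

lemma StepProp.vis {t t2 : ℝ} {Node Vis Vis2 : ℕ → ℤ → Prop} {κ : ℕ} {i : ℤ} 
    (h : StepProp t t2 Node Vis κ i) (hV : ∀ κ i, Node κ i → Vis κ i → Vis2 κ i) : StepProp t t2 Node Vis2 κ i := by
  obtain ⟨κ', hκ, Ch, w, h1, h2, h3⟩ := h
  exact ⟨κ', hκ, Ch, w, fun c hc => ⟨(h1 c hc).1, hV _ _ (h1 c hc).1 (h1 c hc).2.1, (h1 c hc).2.2⟩, h2, h3⟩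

lemma Sys.orbit {T : ℝ → ℝ} {μ : Measure ℝ} {p : ℕ → ℝ} (S : Sys T μ p) : 
    ∀ᵐ x ∂μ, ∀ j, T^[j] x ∈ Icc (0:ℝ) 1 := by
  filter_upwards [S.aeI] with x hx j
  exact S.maps.iterate j hx

lemma Sys.MC {T : ℝ → ℝ} {μ : Measure ℝ} {p : ℕ → ℝ} (S : Sys T μ p) {s C : ℝ} (hs : 0 < s) (hC : 0 < C)
    (h : ∀ u v : ℝ, 0 ≤ u → u ≤ v → v ≤ 1 → μ (Set.Icc u v) ≤ ENNReal.ofReal (C * (v - u) ^ s)) 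
    (l : ℕ) (i : ℤ) : μ.real (Dy l i) ≤ C * 2 ^ (-(l:ℝ) * s) := by
  have := S.prob
  set u := max 0 ((i:ℝ) / 2 ^ l) with hu
  set v := min 1 (((i:ℝ) + 1) / 2 ^ l) with hv
  have h1 : μ (Dy l i) ≤ μ (Icc u v) := by
    apply measure_mono_ae
    filter_upwards [S.aeI] with y hy hyD
    have hyD : y ∈ Dy l i := hyD
    rw [Dy_eq] at hyD
    exact ⟨max_le hy.1 hyD.1, le_min hy.2 hyD.2.le⟩
  have h2l : (0:ℝ) < 2 ^ l := by positivity
  by_cases huv : u ≤ v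
  · have h2 := h1.trans (h u v (le_max_left _ _) huv (min_le_left _ _))
    have h3 : μ.real (Dy l i) ≤ C * (v - u) ^ s := 
      ENNReal.toReal_le_of_le_ofReal (mul_nonneg hC.le (Real.rpow_nonneg (by linarith) _)) h2
    refine h3.trans ?_
    have h4 : v - u ≤ (2:ℝ) ^ (-(l:ℝ)) := by
      have h5 : (2:ℝ) ^ (-(l:ℝ)) = 1 / 2 ^ l := by rw [Real.rpow_neg (by norm_num), Real.rpow_natCast, one_div]
      rw [h5]
      have : v ≤ ((i:ℝ) + 1) / 2 ^ l := min_le_right _ _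
      have : (i:ℝ) / 2 ^ l ≤ u := le_max_right _ _
      have : ((i:ℝ) + 1) / 2 ^ l = (i:ℝ) / 2 ^ l + 1 / 2 ^ l := by ring
      linarith
    rw [Real.rpow_mul (by norm_num)]
    gcongr
  · rw [Icc_eq_empty huv, measure_empty] at h1
    have : μ.real (Dy l i) = 0 := by rw [measureReal_def, nonpos_iff_eq_zero.1 h1]; rfl
    rw [this]; positivity

lemma Sys.lower {T : ℝ → ℝ} {μ : Measure ℝ} {p : ℕ → ℝ} (S : Sys T μ p) {α C t : ℝ} (hα : 0 < α) (hC : 0 < C)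
    (hMC : ∀ (l : ℕ) (i : ℤ), μ.real (Dy l i) ≤ C * 2 ^ (-(l:ℝ) * (1 / α)))
    (ht : 0 < t) (htα : t < 1 / α) {r : ℕ → ℝ} (hr : ∀ n : ℕ, r n = (n : ℝ) ^ (-α)) : 
    ∀ᵐ x ∂μ, ENNReal.ofReal t ≤ dimH (hitSet T x r) := by
  have := S.prob
  set ε := (1 / α - t) / 5 with hεd
  have hε : 0 < ε := by rw [hεd]; linarith
  have hαε : 1 / α = t + 5 * ε := by rw [hεd]; ring
  obtain ⟨Ma, Mb, hMa, hgs⟩ := S.good_scales hε ht htα hC hMC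
  set c : ℝ := 1 / (2 * ((Mb:ℝ) + 1)) with hc
  have hc0 : 0 < c := by positivity
  obtain ⟨κmin, hκmin⟩ : ∃ κmin : ℕ, ∀ κ ≥ κmin, 4 / c ≤ (2:ℝ) ^ (ε * (κ:ℝ)) ∧ 2 ≤ (2:ℝ) ^ ((κ:ℝ) / α) := by
    have h1 : Tendsto (fun κ : ℕ => (2:ℝ) ^ ((κ:ℝ) / α)) atTop atTop := by
      apply (tendsto_rpow_atTop_of_base_gt_one 2 (by norm_num)).comp
      exact tendsto_natCast_atTop_atTop.atTop_div_const hα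
    have h2 : Tendsto (fun κ : ℕ => (2:ℝ) ^ (ε * (κ:ℝ))) atTop atTop := by
      apply (tendsto_rpow_atTop_of_base_gt_one 2 (by norm_num)).comp
      exact tendsto_natCast_atTop_atTop.const_mul_atTop hε
    exact eventually_atTop.1 ((h2.eventually_ge_atTop _).and (h1.eventually_ge_atTop _))
  obtain ⟨κr, ir, hroot, hκr⟩ : ∃ κ i, good μ ε t κ i ∧ κmin ≤ κ := by
    obtain ⟨y, hy⟩ := hgs.exists
    obtain ⟨q, ⟨i, hi, hq⟩, hq2⟩ := (hy.and (eventually_ge_atTop κmin)).exists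
    refine ⟨i * q, _, hq, hq2.trans ?_⟩
    exact Nat.le_mul_of_pos_left _ (hMa.trans (Finset.mem_Icc.1 hi).1)
  have hXt := S.Xv_tendsto (t3 := t + 4 * ε) (ε := ε) (by linarith) hε (N := Nf α) (fun κ => by
    have := Nf_lower (α := α) κ
    have h : (κ:ℝ) * (t + 4 * ε + ε) = κ / α := by
      rw [div_eq_mul_one_div (κ:ℝ) α, hαε]; ring
    rw [h]; exact this)
  have hfreq : ∀ᵐ x ∂μ, ∀ (κ0 : ℕ) (i0 : ℤ), good μ ε t κ0 i0 → 
      ∃ᶠ κ in atTop, c * μ.real (Gs μ ε t κ0 ∩ Dy κ0 i0) ≤ 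
      Av T (Nf α κ) (Hs μ ε t (Gs μ ε t κ0 ∩ Dy κ0 i0) κ) x := by
    rw [ae_all_iff]; intro κ0
    rw [ae_all_iff]; intro i0
    by_cases hg : good μ ε t κ0 i0
    · have hpos : 0 < μ.real (Gs μ ε t κ0 ∩ Dy κ0 i0) := 
        lt_of_lt_of_le (mul_pos (by positivity) hg.1) hg.2
      have := S.limsup (B := Gs μ ε t κ0 ∩ Dy κ0 i0) (H := fun κ => Hs μ ε t (Gs μ ε t κ0 ∩ Dy κ0 i0) κ) 
        ((Gs_meas _ _ _ _).inter (measurableSet_Dy _ _)) hpos (fun κ => Hs_meas _ _ _ _ _) hMa (Mb := Mb) (by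
          filter_upwards [hgs] with y hy hyB
          filter_upwards [hy] with q hq
          obtain ⟨i, hi, hq⟩ := hq
          exact ⟨i, hi, hq, y, rfl, hyB⟩) (Nf_tendsto hα)
      filter_upwards [this] with x hx _
      exact hx
    · exact Eventually.of_forall fun x h => absurd h hg
  filter_upwards [S.orbit, hXt, hfreq] with x hx hX hf
  refine dim_lower ht (t2 := t + 3 * ε) (by linarith) (Node := fun κ i => good μ ε t κ i ∧ κmin ≤ κ)
    (Vis := fun κ i => Vis T (Nf α) x κ i ∧ κmin ≤ κ) (fun κ i hκ => ?_) ⟨hroot, hκr⟩ hx (Nf_tendsto hα) ?_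
  · refine StepProp.vis ?_ (fun κ i h1 h2 => ⟨h2, h1.2⟩)
    exact S.one_step hε ht hC hc0 (by rw [← hαε]; exact hMC) hx hX (fun κ hκ => (hκmin κ hκ).1) hκ.2 hκ.1 (hf κ i hκ.1)
  · rintro κ i ⟨⟨j, hj, hjD⟩, hκ⟩
    rw [Finset.mem_Ico] at hj
    refine ⟨j, hj.1, hjD, ?_⟩
    rw [hr]
    exact Nf_vis hα (hκmin κ hκ).2 hj.1 hj.2

lemma Sys.main {T : ℝ → ℝ} {μ : Measure ℝ} {p : ℕ → ℝ} (S : Sys T μ p) 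
    (s₀ : ℝ) (hs₀ : 0 < s₀)
    (hball : ∀ s : ℝ, 0 < s → s < s₀ → ∃ cs : ℝ, 0 < cs ∧
      ∀ u v : ℝ, 0 ≤ u → u ≤ v → v ≤ 1 →
        μ (Set.Icc u v) ≤ ENNReal.ofReal (cs * (v - u) ^ s))
    (α : ℝ) (hα : 1 / s₀ < α)
    (r : ℕ → ℝ) (hr : ∀ n : ℕ, r n = (n : ℝ) ^ (-α)) :
    ∀ᵐ x ∂μ, dimH (hitSet T x r) = ENNReal.ofReal (1 / α) := by
  have hα0 : 0 < α := lt_trans (by positivity) hα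
  have hs : 1 / α < s₀ := by
    rw [div_lt_iff₀ hs₀] at hα
    rw [div_lt_iff₀ hα0]; linarith
  obtain ⟨C, hC, hCb⟩ := hball (1 / α) (by positivity) hs
  have hMC := S.MC (s := 1 / α) (by positivity) hC hCb
  have h1 : ∀ᵐ x ∂μ, ∀ n : ℕ, ENNReal.ofReal ((1 / α) * (1 - 1 / ((n:ℝ) + 2))) ≤ dimH (hitSet T x r) := by
    rw [ae_all_iff]; intro n
    have hn : (0:ℝ) < n + 2 := by positivity
    have h2 : 1 / ((n:ℝ) + 2) < 1 := by rw [div_lt_one hn]; linarith [(Nat.cast_nonneg n : (0:ℝ) ≤ n)]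
    have h3 : 0 < 1 / ((n:ℝ) + 2) := by positivity
    exact S.lower hα0 hC hMC (mul_pos (by positivity) (by linarith)) 
      (mul_lt_of_lt_one_right (by positivity) (by linarith)) hr
  filter_upwards [h1] with x hx
  refine le_antisymm (dim_upper T x α hα0 r hr) ?_
  have h4 : Tendsto (fun n : ℕ => (1 / α) * (1 - 1 / ((n:ℝ) + 2))) atTop (nhds ((1 / α) * (1 - 0))) := by
    apply Tendsto.const_mul
    apply Tendsto.const_sub
    have : Tendsto (fun n : ℕ => (n:ℝ) + 2) atTop atTop := 
      tendsto_atTop_add_const_right _ _ tendsto_natCast_atTop_atTop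
    exact tendsto_const_nhds.div_atTop this
  rw [sub_zero, mul_one] at h4
  exact le_of_tendsto (ENNReal.tendsto_ofReal h4) (Eventually.of_forall hx)

theorem stmt_3
    (T : ℝ → ℝ) (hT : Set.MapsTo T (Set.Icc (0:ℝ) 1) (Set.Icc (0:ℝ) 1))
    (hTmeas : Measurable T)
    -- the finite partition of [0,1] into intervals
    (m : ℕ) (hm : 0 < m) (a : ℕ → ℝ) (ha0 : a 0 = 0) (ham : a m = 1)
    (hasm : ∀ i < m, a i < a (i + 1))
    -- piecewise monotone, C¹ and uniformly expanding on each partition interval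
    (lam : ℝ) (hlam : 1 < lam)
    (hpiece : ∀ i < m, ∃ U : Set ℝ, IsOpen U ∧ Set.Icc (a i) (a (i + 1)) ⊆ U ∧
      ∃ Ti : ℝ → ℝ, ContDiffOn ℝ 1 Ti U ∧
        (∀ x ∈ Set.Ico (a i) (a (i + 1)), Ti x = T x) ∧
        (StrictMonoOn Ti U ∨ StrictAntiOn Ti U) ∧
        ∀ x ∈ U, lam ≤ |deriv Ti x|)
    -- bounded distortion for the derivative of T
    (hdistT : ∃ D : ℝ, 1 ≤ D ∧ ∀ n : ℕ, ∀ x ∈ Set.Icc (0:ℝ) 1, ∀ y ∈ Set.Icc (0:ℝ) 1,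
      SameCylinder T m a n x y →
        |(∏ k ∈ Finset.range n, deriv T (T^[k] x)) /
          (∏ k ∈ Finset.range n, deriv T (T^[k] y))| ≤ D)
    -- the potential φ has bounded distortion
    (φ : ℝ → ℝ)
    (hdistφ : ∃ Dφ : ℝ, ∀ n : ℕ, ∀ x ∈ Set.Icc (0:ℝ) 1, ∀ y ∈ Set.Icc (0:ℝ) 1,
      SameCylinder T m a n x y →
        |∑ k ∈ Finset.range n, (φ (T^[k] x) - φ (T^[k] y))| ≤ Dφ)
    -- the conformal measure ν_φ and the Gibbs measure μ_φ = h_φ · ν_φ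
    (P : ℝ) (ν : Measure ℝ)
    (hconf : ∀ i < m, ∀ A : Set ℝ, MeasurableSet A → A ⊆ Set.Ico (a i) (a (i + 1)) →
      ν (T '' A) = ∫⁻ x in A, ENNReal.ofReal (Real.exp (P - φ x)) ∂ν)
    (hφ : ℝ → ℝ) (c₁ c₂ : ℝ) (hc₁ : 0 < c₁)
    (hφbd : ∀ x ∈ Set.Icc (0:ℝ) 1, c₁ ≤ hφ x ∧ hφ x ≤ c₂)
    (μφ : Measure ℝ) [IsProbabilityMeasure μφ]
    (hμν : μφ = ν.withDensity (fun x => ENNReal.ofReal (hφ x)))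
    (hsupp : μφ (Set.Icc (0:ℝ) 1)ᶜ = 0)
    (hinv : μφ.map T = μφ)
    -- summable decay of correlations
    (p : ℕ → ℝ) (hppos : ∀ n, 0 < p n) (hpsum : Summable p)
    (hdecay : ∀ f g : ℝ → ℝ, Integrable f μφ → BoundedVariationOn g (Set.Icc (0:ℝ) 1) →
      ∀ n : ℕ,
        |(∫ x, f (T^[n] x) * g x ∂μφ) - (∫ x, f x ∂μφ) * (∫ x, g x ∂μφ)| ≤
          (∫ x, |f x| ∂μφ) *
            ((∫ x, |g x| ∂μφ) + (eVariationOn g (Set.Icc (0:ℝ) 1)).toReal) * p n)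
    -- the measure of intervals decays polynomially
    (s₀ : ℝ) (hs₀ : 0 < s₀)
    (hball : ∀ s : ℝ, 0 < s → s < s₀ → ∃ cs : ℝ, 0 < cs ∧
      ∀ u v : ℝ, 0 ≤ u → u ≤ v → v ≤ 1 →
        μφ (Set.Icc u v) ≤ ENNReal.ofReal (cs * (v - u) ^ s))
    -- the sequence of radii
    (α : ℝ) (hα : 1 / s₀ < α)
    (r : ℕ → ℝ) (hr : ∀ n : ℕ, r n = (n : ℝ) ^ (-α)) :
    ∀ᵐ x ∂μφ, dimH (hitSet T x r) = ENNReal.ofReal (1 / α) := by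
  exact Sys.main ⟨hT, hTmeas, inferInstance, hsupp, hinv, hppos, hpsum, hdecay⟩ s₀ hs₀ hball α hα r hr
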